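/- Let k ≥ 2 be an integer. With high probability p_conn = p_isol; in other words, with high probability the random process associated with Y_p becomes F_2-cohomologically (k−1)-connected at exactly the moment when the last isolated (k−1)-simplex disappears. -/

import Mathlib

open MeasureTheory Filter

attribute [local instance] Classical.propDecidable

namespace RSC

variable {V : Type*}

/-- `A` is an `i`-dimensional simplex of the complex `G`. -/
def IsSimplex (G : Set (Finset V)) (i : ℕ) (A : Finset V) : Prop :=
  A ∈ G ∧ A.card = i + 1

/-- A `k`-dimensional simplicial complex on vertex set `V`. -/
structure IsKComplex (G : Set (Finset V)) (k : ℕ) : Prop where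
  down : ∀ A ∈ G, ∀ B, B ⊆ A → B.Nonempty → B ∈ G
  singletons : ∀ v : V, ({v} : Finset V) ∈ G
  dim : ∀ A ∈ G, A.card ≤ k + 1

/-- `i`-cochains with `F₂`-coefficients. -/
abbrev Cochain (G : Set (Finset V)) (i : ℕ) : Type _ :=
  {A : Finset V // IsSimplex G i A} → ZMod 2

/-- The coboundary map `δ^i : C^i(G) → C^{i+1}(G)`. -/
noncomputable def coboundary (G : Set (Finset V)) (i : ℕ) :
    Cochain G i →ₗ[ZMod 2] Cochain G (i + 1) where
  toFun f := fun σ => ∑ τ ∈ Finset.powersetCard (i + 1) (σ : Finset V),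
      if h : IsSimplex G i τ then f ⟨τ, h⟩ else 0
  map_add' f g := by
    funext σ
    simp only [Pi.add_apply, ← Finset.sum_add_distrib]
    refine Finset.sum_congr rfl fun τ _ => ?_
    by_cases h : IsSimplex G i τ <;> simp [h]
  map_smul' c f := by
    funext σ
    simp only [Pi.smul_apply, RingHom.id_apply, Finset.smul_sum]
    refine Finset.sum_congr rfl fun τ _ => ?_
    by_cases h : IsSimplex G i τ <;> simp [h]

/-- The submodule of `i`-cocycles. -/
noncomputable def cocycles (G : Set (Finset V)) (i : ℕ) : Submodule (ZMod 2) (Cochain G i) :=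
  LinearMap.ker (coboundary G i)

/-- The submodule of `i`-coboundaries (`δ^{-1}` is the zero map). -/
noncomputable def coboundaries (G : Set (Finset V)) : (i : ℕ) → Submodule (ZMod 2) (Cochain G i)
  | 0 => ⊥
  | (i + 1) => LinearMap.range (coboundary G i)

/-- The `i`-th cohomology group `H^i(G;F₂) = ker δ^i / im δ^{i-1}`. -/
noncomputable abbrev cohomology (G : Set (Finset V)) (i : ℕ) :=
  (cocycles G i) ⧸ ((coboundaries G i).comap (cocycles G i).subtype)

/-- `F₂`-cohomological `j`-connectedness: `H^0 ≅ F₂` and `H^i = 0` for `1 ≤ i ≤ j`. -/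
def CohomConnected (G : Set (Finset V)) (j : ℕ) : Prop :=
  Nonempty (cohomology G 0 ≃ₗ[ZMod 2] ZMod 2) ∧
    ∀ i, 1 ≤ i → i ≤ j → Subsingleton (cohomology G i)

/-- The `j`-flower in `K` with centre `C`: the set of petals `C ∪ {w}`, `w ∈ K \ C`. -/
def Flower [DecidableEq V] (K C : Finset V) : Set (Finset V) :=
  {P | ∃ w ∈ K \ C, P = insert w C}

/-- A copy of `M_j^-`: a `k`-simplex `K` together with a `(j-1)`-simplex `C ⊆ K` such that
each petal of the flower `F(K,C)` is contained in no `k`-simplex other than `K`. -/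
def IsMjMinus [DecidableEq V] (G : Set (Finset V)) (k j : ℕ) (K C : Finset V) : Prop :=
  IsSimplex G k K ∧ C ∈ G ∧ C.card = j ∧ C ⊆ K ∧
    ∀ P ∈ Flower K C, ∀ K', IsSimplex G k K' → P ⊆ K' → K' = K

/-- A `j`-cycle: every `(j-1)`-simplex lies in an even number of members of `J`. -/
def IsCycle (G : Set (Finset V)) (j : ℕ) (J : Finset (Finset V)) : Prop :=
  (∀ σ ∈ J, IsSimplex G j σ) ∧
    ∀ τ : Finset V, τ.card = j → Even (J.filter (fun σ => τ ⊆ σ)).card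

/-- A copy of `M_j`. -/
def IsMj [DecidableEq V] (G : Set (Finset V)) (k j : ℕ) (K C : Finset V)
    (J : Finset (Finset V)) : Prop :=
  IsMjMinus G k j K C ∧ IsCycle G j J ∧ ∃! P : Finset V, P ∈ J ∧ P ∈ Flower K C

/-- A `j`-shell: a `(j+2)`-set all of whose `(j+1)`-subsets are `j`-simplices. -/
def IsShell (G : Set (Finset V)) (j : ℕ) (A : Finset V) : Prop :=
  A.card = j + 2 ∧ ∀ τ ⊆ A, τ.card = j + 1 → τ ∈ G

/-- A copy of `M_j^*`. -/
def IsMjStar [DecidableEq V] (G : Set (Finset V)) (k j : ℕ) (K C : Finset V) (w a : V) : Prop :=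
  IsMjMinus G k j K C ∧ w ∈ K \ C ∧ a ∉ K ∧ IsShell G j (insert a (insert w C))

/-- The support of a cochain. -/
def cochainSupport {G : Set (Finset V)} {i : ℕ} (f : Cochain G i) : Set (Finset V) :=
  {A | ∃ h : IsSimplex G i A, f ⟨A, h⟩ = 1}

/-- A cochain arising from a copy of `M_j^-`: its support is the flower `F(K,C)`. -/
def ArisesFrom [DecidableEq V] (G : Set (Finset V)) (k j : ℕ) (f : Cochain G j)
    (K C : Finset V) : Prop :=
  IsMjMinus G k j K C ∧ cochainSupport f = Flower K C

/-- A `j`-cocycle generated by copies of `M_j^-`: it differs by a `j`-coboundary from a sum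
of `j`-cocycles arising from copies of `M_j^-`. -/
def GeneratedByMjMinus [DecidableEq V] (G : Set (Finset V)) (k j : ℕ) (f : Cochain G j) : Prop :=
  ∃ (m : ℕ) (fs : Fin m → Cochain G j),
    (∀ i, ∃ K C, ArisesFrom G k j (fs i) K C) ∧
      f - (∑ i, fs i) ∈ coboundaries G j

/-- Membership in `N_G`: a `j`-cocycle not generated by copies of `M_j^-`. -/
def InNG [DecidableEq V] (G : Set (Finset V)) (k j : ℕ) (f : Cochain G j) : Prop :=
  f ∈ cocycles G j ∧ ¬ GeneratedByMjMinus G k j f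

/-- Traversability: the transitive closure of "lying in a common `k`-simplex" is `S × S`. -/
def Traversable (G : Set (Finset V)) (k : ℕ) (S : Set (Finset V)) : Prop :=
  ∀ σ₁ ∈ S, ∀ σ₂ ∈ S,
    Relation.TransGen
      (fun a b => a ∈ S ∧ b ∈ S ∧ ∃ K, IsSimplex G k K ∧ a ⊆ K ∧ b ⊆ K) σ₁ σ₂

/-- A local obstacle: a `k`-simplex containing at least `k-j+1` many `j`-simplices,
each lying in no other `k`-simplex. -/
def IsLocalObstacle (G : Set (Finset V)) (k j : ℕ) (K : Finset V) : Prop :=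
  IsSimplex G k K ∧
    k - j + 1 ≤ {σ : Finset V | IsSimplex G j σ ∧ σ ⊆ K ∧
      ∀ K', IsSimplex G k K' → σ ⊆ K' → K' = K}.ncard

/-- The random complex `G_p` given birth times `t`: all singletons together with all
non-empty subsets of `(k+1)`-sets with birth time at most `p`. -/
def complexAt (k n : ℕ) (t : Finset (Fin n) → ℝ) (p : ℝ) : Set (Finset (Fin n)) :=
  {A | (∃ v, A = {v}) ∨
    (A.Nonempty ∧ ∃ K : Finset (Fin n), K.card = k + 1 ∧ t K ≤ p ∧ A ⊆ K)}

/-- The distribution of birth times: i.i.d. uniform on `[0,1]`. -/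
noncomputable def birthMeasure (n : ℕ) : Measure (Finset (Fin n) → ℝ) :=
  Measure.pi fun _ => volume.restrict (Set.Icc (0 : ℝ) 1)

/-- `p_{M_j}`: the supremum of the probabilities `p ∈ [0,1]` at which `G_p` contains
a copy of `M_j`. -/
noncomputable def pMj (k j n : ℕ) (t : Finset (Fin n) → ℝ) : ℝ :=
  sSup {p : ℝ | p ∈ Set.Icc (0 : ℝ) 1 ∧
    ∃ K C J, IsMj (complexAt k n t p) k j K C J}

/-- The threshold `p_j`. -/
noncomputable def pjThreshold (k j n : ℕ) : ℝ :=
  ((j + 1 : ℝ) * Real.log n + Real.log (Real.log n)) * (Nat.factorial (k - j)) /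
    (((k - j + 1 : ℕ) : ℝ) * (n : ℝ) ^ (k - j))

/-- `p_j^-`. -/
noncomputable def pjMinus (k j n : ℕ) : ℝ :=
  (1 - 1 / Real.sqrt (Real.log n)) * ((j + 1 : ℝ) * Real.log n) * (Nat.factorial (k - j)) /
    (((k - j + 1 : ℕ) : ℝ) * (n : ℝ) ^ (k - j))

/-- `p_{j-1}^-`. -/
noncomputable def pjPrevMinus (k j n : ℕ) : ℝ :=
  (1 - 1 / Real.sqrt (Real.log n)) * ((j : ℝ) * Real.log n) * (Nat.factorial (k - j + 1)) /
    (((k - j + 2 : ℕ) : ℝ) * (n : ℝ) ^ (k - j + 1))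

/-- `p_j^{(1)}`. -/
noncomputable def pjOne (k j n : ℕ) : ℝ :=
  1 / (10 * ((j : ℝ) + 1) * (Nat.choose (k + 1) (j + 1)) * (n : ℝ) ^ (k - j))

/-- The number of copies of `M_j^-` in `G`. -/
noncomputable def countMjMinus (k j : ℕ) {n : ℕ} (G : Set (Finset (Fin n))) : ℕ :=
  {x : Finset (Fin n) × Finset (Fin n) | IsMjMinus G k j x.1 x.2}.ncard

/-- The number of copies of `M_j^*` in `G`. -/
noncomputable def countMjStar (k j : ℕ) {n : ℕ} (G : Set (Finset (Fin n))) : ℕ :=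
  {x : Finset (Fin n) × Finset (Fin n) × Fin n × Fin n |
    IsMjStar G k j x.1 x.2.1 x.2.2.1 x.2.2.2}.ncard

/-- The Linial–Meshulam complex `Y_p`: the full `(k-1)`-skeleton together with the
`(k+1)`-sets of birth time at most `p`. -/
def complexY (k n : ℕ) (t : Finset (Fin n) → ℝ) (p : ℝ) : Set (Finset (Fin n)) :=
  {A | (A.Nonempty ∧ A.card ≤ k) ∨ (A.card = k + 1 ∧ t A ≤ p)}

/-- `p_isol`: the supremum of the `p ∈ [0,1]` at which `Y_p` contains an isolated
`(k-1)`-simplex. -/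
noncomputable def pIsol (k n : ℕ) (t : Finset (Fin n) → ℝ) : ℝ :=
  sSup {p : ℝ | p ∈ Set.Icc (0 : ℝ) 1 ∧
    ∃ σ : Finset (Fin n), IsSimplex (complexY k n t p) (k - 1) σ ∧
      ∀ K : Finset (Fin n), IsSimplex (complexY k n t p) k K → ¬ σ ⊆ K}

/-- `p_conn`: the supremum of the `p ∈ [0,1]` at which `H^{k-1}(Y_p;F₂) ≠ 0`. -/
noncomputable def pConn (k n : ℕ) (t : Finset (Fin n) → ℝ) : ℝ :=
  sSup {p : ℝ | p ∈ Set.Icc (0 : ℝ) 1 ∧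
    ¬ Subsingleton (cohomology (complexY k n t p) (k - 1))}

section Combinatorics

variable {n : ℕ}

/-- The coboundary operator on functions on all finite sets. -/
noncomputable def cobd (f : Finset (Fin n) → ZMod 2) (σ : Finset (Fin n)) : ZMod 2 :=
  ∑ x ∈ σ, f (σ.erase x)

lemma zmod2_add_self (a : ZMod 2) : a + a = 0 := CharTwo.add_self_eq_zero a

lemma cobd_add (f g : Finset (Fin n) → ZMod 2) (σ : Finset (Fin n)) :
    cobd (f + g) σ = cobd f σ + cobd g σ := by
  simp [cobd, Finset.sum_add_distrib]

lemma cobd_congr {k : ℕ} {f g : Finset (Fin n) → ZMod 2}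
    (h : ∀ σ : Finset (Fin n), σ.card = k → f σ = g σ)
    {K : Finset (Fin n)} (hK : K.card = k + 1) : cobd f K = cobd g K := by
  refine Finset.sum_congr rfl fun x hx => h _ ?_
  rw [Finset.card_erase_of_mem hx, hK]; rfl

lemma cobd_cobd (g : Finset (Fin n) → ZMod 2) (K : Finset (Fin n)) : cobd (cobd g) K = 0 := by
  unfold cobd
  rw [Finset.sum_sigma']
  refine Finset.sum_involution (fun a _ => ⟨a.2, a.1⟩) ?_ ?_ ?_ ?_
  · rintro ⟨x, y⟩ h
    simp only
    rw [Finset.erase_right_comm]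
    exact zmod2_add_self _
  · rintro ⟨x, y⟩ h _ he
    simp only [Finset.mem_sigma, Finset.mem_erase] at h
    simp only [Sigma.mk.injEq] at he
    exact h.2.1 he.1
  · rintro ⟨x, y⟩ h
    simp only [Finset.mem_sigma, Finset.mem_erase] at h ⊢
    exact ⟨h.2.2, fun e => h.2.1 e.symm, h.1⟩
  · rintro ⟨x, y⟩ h
    rfl

/-- The link of a cochain at a vertex. -/
noncomputable def linkAt (v : Fin n) (f : Finset (Fin n) → ZMod 2) (τ : Finset (Fin n)) : ZMod 2 :=
  if v ∈ τ then 0 else f (insert v τ)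

lemma cobd_linkAt_mem (v : Fin n) (f : Finset (Fin n) → ZMod 2) (σ : Finset (Fin n)) (hv : v ∈ σ) :
    cobd (linkAt v f) σ = f σ := by
  unfold cobd
  rw [Finset.sum_eq_single_of_mem v hv]
  · simp [linkAt, Finset.insert_erase hv]
  · intro x hx hxv
    have : v ∈ σ.erase x := Finset.mem_erase.2 ⟨fun e => hxv e.symm, hv⟩
    simp [linkAt, this]

lemma cobd_linkAt_notMem (v : Fin n) (f : Finset (Fin n) → ZMod 2) (σ : Finset (Fin n))
    (hv : v ∉ σ) : f σ + cobd (linkAt v f) σ = cobd f (insert v σ) := by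
  unfold cobd
  rw [Finset.sum_insert hv, Finset.erase_insert hv]
  congr 1
  refine Finset.sum_congr rfl fun x hx => ?_
  have h1 : v ∉ σ.erase x := fun h => hv (Finset.mem_of_mem_erase h)
  have h2 : v ≠ x := fun e => hv (e ▸ hx)
  simp only [linkAt, h1, if_false]
  rw [Finset.erase_insert_of_ne h2]

/-- All `k`-subsets. -/
noncomputable def layer (n k : ℕ) : Finset (Finset (Fin n)) := Finset.powersetCard k Finset.univ

lemma mem_layer {k : ℕ} {σ : Finset (Fin n)} : σ ∈ layer n k ↔ σ.card = k := by
  simp [layer, Finset.mem_powersetCard]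

lemma card_layer (n k : ℕ) : (layer n k).card = n.choose k := by
  simp [layer]

noncomputable def supp (k : ℕ) (f : Finset (Fin n) → ZMod 2) : Finset (Finset (Fin n)) :=
  (layer n k).filter (fun σ => f σ ≠ 0)

lemma mem_supp {k : ℕ} {f : Finset (Fin n) → ZMod 2} {σ : Finset (Fin n)} :
    σ ∈ supp k f ↔ σ.card = k ∧ f σ ≠ 0 := by
  simp [supp, mem_layer]

noncomputable def ind (S : Finset (Finset (Fin n))) (σ : Finset (Fin n)) : ZMod 2 :=
  if σ ∈ S then 1 else 0

lemma zmod2_ne_zero {a : ZMod 2} (h : a ≠ 0) : a = 1 := by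
  revert a; decide

lemma ind_supp {k : ℕ} (f : Finset (Fin n) → ZMod 2) (σ : Finset (Fin n)) (h : σ.card = k) :
    ind (supp k f) σ = f σ := by
  unfold ind
  by_cases hf : f σ = 0
  · simp [mem_supp, hf]
  · simp [mem_supp, hf, h, zmod2_ne_zero hf]

/-- Weight-minimality modulo coboundaries. -/
def MinClass (k : ℕ) (f : Finset (Fin n) → ZMod 2) : Prop :=
  ∀ g : Finset (Fin n) → ZMod 2, (supp k f).card ≤ (supp k (f + cobd g)).card

lemma expansion {k : ℕ} (f : Finset (Fin n) → ZMod 2) (hf : MinClass k f) :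
    n * (supp k f).card ≤ (k + 1) * (supp (k + 1) (cobd f)).card := by
  have h1 : ∀ v : Fin n, (supp k f).card ≤ ((supp (k + 1) (cobd f)).filter (fun K => v ∈ K)).card := by
    intro v
    refine (hf (linkAt v f)).trans ?_
    refine Finset.card_le_card_of_injOn (fun σ => insert v σ) ?_ ?_
    · intro σ hσ
      have hσ' := mem_supp.1 (Finset.mem_coe.1 hσ)
      have hv : v ∉ σ := by
        intro hv
        apply hσ'.2
        simp only [Pi.add_apply]
        rw [cobd_linkAt_mem v f σ hv]; exact zmod2_add_self _
      simp only [Finset.coe_filter, Set.mem_setOf_eq, mem_supp]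
      refine ⟨⟨by rw [Finset.card_insert_of_notMem hv, hσ'.1], ?_⟩, Finset.mem_insert_self _ _⟩
      rw [← cobd_linkAt_notMem v f σ hv]; exact hσ'.2
    · intro σ hσ τ hτ he
      have hv : ∀ σ ∈ supp k (f + cobd (linkAt v f)), v ∉ σ := by
        intro σ hσ hv
        apply (mem_supp.1 hσ).2
        simp only [Pi.add_apply]
        rw [cobd_linkAt_mem v f σ hv]; exact zmod2_add_self _
      have a := hv _ (Finset.mem_coe.1 hσ)
      have b := hv _ (Finset.mem_coe.1 hτ)
      simp only at he
      rw [← Finset.erase_insert a, he, Finset.erase_insert b]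
  have h2 : ∑ v : Fin n, ((supp (k + 1) (cobd f)).filter (fun K => v ∈ K)).card
      = (k + 1) * (supp (k + 1) (cobd f)).card := by
    simp only [Finset.card_filter]
    rw [Finset.sum_comm]
    rw [Finset.sum_congr rfl (g := fun _ => k + 1)]
    · simp [mul_comm]
    · intro K hK
      have := (mem_supp.1 hK).1
      simp [this]
  rw [← h2]
  calc n * (supp k f).card = ∑ v : Fin n, (supp k f).card := by simp
    _ ≤ _ := Finset.sum_le_sum fun v _ => h1 v

lemma union_eq_of_faces {k : ℕ} {σ τ K : Finset (Fin n)} (hσ : σ.card = k) (hτ : τ.card = k)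
    (hK : K.card = k + 1) (h1 : σ ⊆ K) (h2 : τ ⊆ K) (hne : σ ≠ τ) : σ ∪ τ = K := by
  apply Finset.eq_of_subset_of_card_le (Finset.union_subset h1 h2)
  rw [hK]
  by_contra hlt
  push Not at hlt
  have h3 : σ = σ ∪ τ := Finset.eq_of_subset_of_card_le Finset.subset_union_left (by omega)
  have h4 : τ = σ ∪ τ := Finset.eq_of_subset_of_card_le Finset.subset_union_right (by omega)
  exact hne (h3.trans h4.symm)

/-- the `(k+1)`-sets containing `σ`. -/
noncomputable def upper (σ : Finset (Fin n)) : Finset (Finset (Fin n)) :=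
  (Finset.univ \ σ).image (fun v => insert v σ)

lemma card_upper (σ : Finset (Fin n)) : (upper σ).card = n - σ.card := by
  unfold upper
  rw [Finset.card_image_of_injOn, Finset.card_sdiff_of_subset (Finset.subset_univ _)]
  · simp
  · intro a ha b hb h
    have ha' : a ∉ σ := by simpa using ha
    have : a ∈ insert b σ := by
      have h' : insert a σ = insert b σ := h
      rw [← h']; exact Finset.mem_insert_self _ _
    rcases Finset.mem_insert.1 this with h | h
    · exact h
    · exact absurd h ha'

lemma mem_upper {σ K : Finset (Fin n)} : K ∈ upper σ ↔ σ ⊆ K ∧ K.card = σ.card + 1 := by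
  unfold upper
  constructor
  · intro h
    obtain ⟨v, hv, rfl⟩ := Finset.mem_image.1 h
    have hv' : v ∉ σ := by simpa using hv
    exact ⟨Finset.subset_insert _ _, Finset.card_insert_of_notMem hv'⟩
  · rintro ⟨h1, h2⟩
    have : (K \ σ).card = 1 := by rw [Finset.card_sdiff_of_subset h1]; omega
    obtain ⟨v, hv⟩ := Finset.card_eq_one.1 this
    have hvm : v ∈ K \ σ := by rw [hv]; simp
    refine Finset.mem_image.2 ⟨v, by simpa using (Finset.mem_sdiff.1 hvm).2, ?_⟩
    apply Finset.eq_of_subset_of_card_le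
    · exact Finset.insert_subset (Finset.mem_sdiff.1 hvm).1 h1
    · rw [Finset.card_insert_of_notMem (Finset.mem_sdiff.1 hvm).2, h2]

/-- if `σ` is the only face of `K` in the support then the coboundary is nonzero -/
lemma cobd_single {k : ℕ} (f : Finset (Fin n) → ZMod 2) {σ K : Finset (Fin n)}
    (hσ : σ.card = k) (hK : K.card = k + 1) (hs : σ ⊆ K)
    (h : ∀ τ : Finset (Fin n), τ.card = k → τ ⊆ K → τ ≠ σ → f τ = 0) : cobd f K = f σ := by
  have hu : K ∈ upper σ := mem_upper.2 ⟨hs, by omega⟩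
  unfold upper at hu
  obtain ⟨v, hv, rfl⟩ := Finset.mem_image.1 hu
  have hv' : v ∉ σ := by simpa using hv
  unfold cobd
  rw [Finset.sum_eq_single_of_mem v (Finset.mem_insert_self _ _), Finset.erase_insert hv']
  intro x hx hxv
  apply h
  · rw [Finset.card_erase_of_mem hx, hK]; rfl
  · exact Finset.erase_subset _ _
  · intro he
    have : v ∈ (insert v σ).erase x := Finset.mem_erase.2 ⟨fun e => hxv e.symm, Finset.mem_insert_self _ _⟩
    rw [he] at this
    exact hv' this

lemma small_expansion {k : ℕ} (f : Finset (Fin n) → ZMod 2) :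
    (supp k f).card * ((n - k) - ((supp k f).card - 1)) ≤ (supp (k + 1) (cobd f)).card := by
  set S := supp k f with hS
  let T : Finset (Fin n) → Finset (Finset (Fin n)) := fun σ =>
    upper σ \ (S.erase σ).image (fun τ => σ ∪ τ)
  have key : ∀ σ ∈ S, ∀ K ∈ T σ, K.card = k + 1 ∧ σ ⊆ K ∧ ∀ τ ∈ S, τ ⊆ K → τ = σ := by
    intro σ hσ K hK
    obtain ⟨hK1, hK2⟩ := Finset.mem_sdiff.1 hK
    have hσ' := mem_supp.1 hσ
    have hK1' := mem_upper.1 hK1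
    refine ⟨by rw [hK1'.2, hσ'.1], hK1'.1, fun τ hτ hs => ?_⟩
    by_contra hne
    apply hK2
    refine Finset.mem_image.2 ⟨τ, Finset.mem_erase.2 ⟨hne, hτ⟩, ?_⟩
    exact union_eq_of_faces hσ'.1 (mem_supp.1 hτ).1 (by rw [hK1'.2, hσ'.1]) hK1'.1 hs
      (fun e => hne e.symm)
  have hsub : S.biUnion T ⊆ supp (k + 1) (cobd f) := by
    intro K hK
    obtain ⟨σ, hσ, hKT⟩ := Finset.mem_biUnion.1 hK
    obtain ⟨h1, h2, h3⟩ := key σ hσ K hKT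
    have hσ' := mem_supp.1 hσ
    refine mem_supp.2 ⟨h1, ?_⟩
    rw [cobd_single f hσ'.1 h1 h2]
    · exact hσ'.2
    · intro τ hτ hτK hne
      by_contra h0
      exact hne (h3 τ (mem_supp.2 ⟨hτ, h0⟩) hτK)
  have hdisj : (S : Set (Finset (Fin n))).PairwiseDisjoint T := by
    intro σ hσ τ hτ hne
    refine Finset.disjoint_left.2 fun K hK1 hK2 => hne ?_
    exact ((key σ hσ K hK1).2.2 τ hτ (key τ hτ K hK2).2.1).symm
  calc S.card * ((n - k) - (S.card - 1)) = ∑ σ ∈ S, ((n - k) - (S.card - 1)) := by simp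
    _ ≤ ∑ σ ∈ S, (T σ).card := by
        refine Finset.sum_le_sum fun σ hσ => ?_
        have h1 : (upper σ).card = n - k := by rw [card_upper, (mem_supp.1 hσ).1]
        have h2 : ((S.erase σ).image (fun τ => σ ∪ τ)).card ≤ S.card - 1 :=
          Finset.card_image_le.trans (by rw [Finset.card_erase_of_mem hσ])
        have h3 := Finset.le_card_sdiff ((S.erase σ).image (fun τ => σ ∪ τ)) (upper σ)
        show _ ≤ (upper σ \ _).card
        omega
    _ = (S.biUnion T).card := (Finset.card_biUnion hdisj).symm
    _ ≤ _ := Finset.card_le_card hsub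

end Combinatorics

section Connectivity

variable {n : ℕ}

/-- Two `k`-sets joined by a `(k+1)`-set in `Y`. -/
def StepIn (k : ℕ) (Y : Set (Finset (Fin n))) (σ τ : Finset (Fin n)) : Prop :=
  (σ ∪ τ).card = k + 1 ∧ σ ∪ τ ∈ Y

def IsoAt (k : ℕ) (Y : Set (Finset (Fin n))) (σ : Finset (Fin n)) : Prop :=
  ∀ K : Finset (Fin n), K.card = k + 1 → K ∈ Y → ¬ σ ⊆ K

def Coc (k : ℕ) (Y : Set (Finset (Fin n))) (f : Finset (Fin n) → ZMod 2) : Prop :=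
  ∀ K : Finset (Fin n), K.card = k + 1 → K ∈ Y → cobd f K = 0

/-- Cochains generated by coboundaries and isolated simplices. -/
def GenIso (k : ℕ) (Y : Set (Finset (Fin n))) (f : Finset (Fin n) → ZMod 2) : Prop :=
  ∃ g h : Finset (Fin n) → ZMod 2,
    (∀ σ : Finset (Fin n), σ.card = k → h σ ≠ 0 → IsoAt k Y σ) ∧
    ∀ σ : Finset (Fin n), σ.card = k → f σ = cobd g σ + h σ

lemma GenIso.add {k : ℕ} {Y : Set (Finset (Fin n))} {f f' : Finset (Fin n) → ZMod 2}
    (h : GenIso k Y f) (h' : GenIso k Y f') : GenIso k Y (f + f') := by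
  obtain ⟨g, a, h1, h2⟩ := h
  obtain ⟨g', a', h1', h2'⟩ := h'
  refine ⟨g + g', a + a', fun σ hσ hne => ?_, fun σ hσ => ?_⟩
  · by_cases h0 : a σ = 0
    · refine h1' σ hσ fun h0' => hne ?_
      simp [h0, h0']
    · exact h1 σ hσ h0
  · rw [cobd_add]
    simp only [Pi.add_apply]
    rw [h2 σ hσ, h2' σ hσ]; ring

lemma GenIso.cobd {k : ℕ} {Y : Set (Finset (Fin n))} (g : Finset (Fin n) → ZMod 2) :
    GenIso k Y (cobd g) :=
  ⟨g, 0, fun σ _ h => absurd rfl h, fun σ _ => by simp⟩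

lemma Coc.add {k : ℕ} {Y : Set (Finset (Fin n))} {f f' : Finset (Fin n) → ZMod 2}
    (h : Coc k Y f) (h' : Coc k Y f') : Coc k Y (f + f') := by
  intro K hK hY
  rw [cobd_add, h K hK hY, h' K hK hY, add_zero]

lemma Coc.cobd {k : ℕ} {Y : Set (Finset (Fin n))} (g : Finset (Fin n) → ZMod 2) :
    Coc k Y (cobd g) := fun K _ _ => cobd_cobd g K

lemma fun_add_self (f : Finset (Fin n) → ZMod 2) : f + f = 0 := by
  funext σ; exact zmod2_add_self _

lemma exists_connected {k : ℕ} {Y : Set (Finset (Fin n))} {f₀ : Finset (Fin n) → ZMod 2}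
    (hc : Coc k Y f₀) (hg : ¬ GenIso k Y f₀) :
    ∃ f : Finset (Fin n) → ZMod 2, Coc k Y f ∧ MinClass k f ∧ 2 ≤ (supp k f).card ∧
      ∃ σ₀ ∈ supp k f, ∀ σ ∈ supp k f,
        Relation.ReflTransGen (fun a b => StepIn k Y a b ∧ b ∈ supp k f) σ₀ σ := by
  have hex : ∃ m, ∃ f : Finset (Fin n) → ZMod 2, Coc k Y f ∧ ¬ GenIso k Y f ∧ (supp k f).card = m :=
    ⟨_, f₀, hc, hg, rfl⟩
  obtain ⟨f, hf1, hf2, hf3⟩ := Nat.find_spec hex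
  have hmin : ∀ f' : Finset (Fin n) → ZMod 2, Coc k Y f' → (supp k f').card < (supp k f).card →
      GenIso k Y f' := by
    intro f' h1 h2
    by_contra h3
    exact Nat.find_min hex (hf3 ▸ h2) ⟨f', h1, h3, rfl⟩
  have hMin : MinClass k f := by
    intro g
    by_contra hlt
    push Not at hlt
    have h1 := hmin (f + cobd g) (hf1.add (Coc.cobd g)) hlt
    have h2 := h1.add (GenIso.cobd (k := k) (Y := Y) g)
    rw [add_assoc, fun_add_self, add_zero] at h2
    exact hf2 h2
  have hne : (supp k f).Nonempty := by
    by_contra h0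
    rw [Finset.not_nonempty_iff_eq_empty] at h0
    apply hf2
    refine ⟨0, 0, fun σ _ h => absurd rfl h, fun σ hσ => ?_⟩
    have : σ ∉ supp k f := by rw [h0]; simp
    rw [mem_supp] at this
    have h' : f σ = 0 := by tauto
    simp [h', RSC.cobd]
  obtain ⟨σ₀, hσ₀⟩ := hne
  refine ⟨f, hf1, hMin, ?_, σ₀, hσ₀, ?_⟩
  · by_contra hlt
    have h1 : (supp k f).card = 1 := by
      have := Finset.card_pos.2 ⟨σ₀, hσ₀⟩
      omega
    obtain ⟨σ, hσ⟩ := Finset.card_eq_one.1 h1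
    have hσm : σ ∈ supp k f := by rw [hσ]; simp
    have hσm' := mem_supp.1 hσm
    apply hf2
    refine ⟨0, f, fun τ hτ hne => ?_, fun τ _ => by simp [RSC.cobd]⟩
    have : τ ∈ supp k f := mem_supp.2 ⟨hτ, hne⟩
    rw [hσ, Finset.mem_singleton] at this
    subst this
    intro K hK hY hs
    have h2 := hf1 K hK hY
    rw [cobd_single f hτ hK hs] at h2
    · exact hne h2
    · intro ρ hρ hρK hne'
      by_contra h0
      have : ρ ∈ supp k f := mem_supp.2 ⟨hρ, h0⟩
      rw [hσ, Finset.mem_singleton] at this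
      exact hne' this
  · by_contra hcon
    push Not at hcon
    obtain ⟨σ₁, hσ₁, hnot⟩ := hcon
    set R : Finset (Fin n) → Prop := fun σ =>
      Relation.ReflTransGen (fun a b => StepIn k Y a b ∧ b ∈ supp k f) σ₀ σ with hR
    let f1 : Finset (Fin n) → ZMod 2 := fun σ => if R σ then f σ else 0
    let f2 : Finset (Fin n) → ZMod 2 := fun σ => if R σ then 0 else f σ
    have hsum : f1 + f2 = f := by
      funext σ
      simp only [f1, f2, Pi.add_apply]
      split_ifs <;> simp
    have hRmem : ∀ σ, R σ → σ ∈ supp k f := by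
      intro σ h
      rcases Relation.ReflTransGen.cases_tail h with h | ⟨_, _, h⟩
      · rw [h]; exact hσ₀
      · exact h.2
    have hc1 : Coc k Y f1 := by
      intro K hK hY
      by_cases hE : ∃ σ : Finset (Fin n), R σ ∧ σ ⊆ K
      · obtain ⟨σ, hσR, hσK⟩ := hE
        rw [← hf1 K hK hY]
        refine Finset.sum_congr rfl fun x hx => ?_
        have hcard : (K.erase x).card = k := by rw [Finset.card_erase_of_mem hx, hK]; rfl
        by_cases h0 : f (K.erase x) = 0
        · simp [f1, h0]
        have hin : K.erase x ∈ supp k f := mem_supp.2 ⟨hcard, h0⟩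
        have : R (K.erase x) := by
          by_cases he : σ = K.erase x
          · rw [← he]; exact hσR
          have hu := union_eq_of_faces (mem_supp.1 (hRmem _ hσR)).1 hcard hK hσK
            (Finset.erase_subset _ _) he
          exact Relation.ReflTransGen.tail hσR ⟨⟨by rw [hu, hK], by rw [hu]; exact hY⟩, hin⟩
        simp [f1, this]
      · refine Finset.sum_eq_zero fun x hx => ?_
        have : ¬ R (K.erase x) := fun h => hE ⟨_, h, Finset.erase_subset _ _⟩
        simp [f1, this]
    have hc2 : Coc k Y f2 := by
      have : f2 = f + f1 := by
        rw [← hsum, add_comm f1 f2, add_assoc, fun_add_self, add_zero]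
      rw [this]; exact hf1.add hc1
    have hl1 : (supp k f1).card < (supp k f).card := by
      apply Finset.card_lt_card
      refine (Finset.ssubset_iff_of_subset ?_).2 ⟨σ₁, hσ₁, ?_⟩
      · intro σ h
        by_cases hRσ : R σ
        · exact hRmem _ hRσ
        · exact absurd (by simp [f1, hRσ]) (mem_supp.1 h).2
      · intro h
        exact (mem_supp.1 h).2 (by simp only [f1]; exact if_neg hnot)
    have hl2 : (supp k f2).card < (supp k f).card := by
      apply Finset.card_lt_card
      refine (Finset.ssubset_iff_of_subset ?_).2 ⟨σ₀, hσ₀, ?_⟩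
      · intro σ h
        obtain ⟨h1, h2⟩ := mem_supp.1 h
        refine mem_supp.2 ⟨h1, fun h0 => h2 ?_⟩
        simp [f2, h0]
      · intro h
        exact (mem_supp.1 h).2 (by simp only [f2]; exact if_pos Relation.ReflTransGen.refl)
    apply hf2
    rw [← hsum]
    exact (hmin f1 hc1 hl1).add (hmin f2 hc2 hl2)

lemma exists_walk_aux {α : Type*} (r : α → α → Prop) (hr : ∀ a b, r a b → r b a)
    (S : Finset α) (s₀ : α) (h₀ : s₀ ∈ S)
    (hS : ∀ s ∈ S, Relation.ReflTransGen (fun a b => r a b ∧ b ∈ S) s₀ s) (j : ℕ) (hj : j + 1 ≤ S.card) :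
    ∃ l : List α, l.IsChain r ∧ s₀ ∈ l ∧ (∀ a ∈ l, a ∈ S) ∧ l.toFinset.card = j + 1 ∧
      l.length = 2 * j + 1 := by
  induction j with
  | zero => exact ⟨[s₀], by simp, by simp, by simpa using h₀, by simp, by simp⟩
  | succ j ih =>
    obtain ⟨l, h1, h2, h3, h4, h5⟩ := ih (by omega)
    have hedge : ∃ a b, a ∈ l ∧ b ∉ l ∧ b ∈ S ∧ r a b := by
      by_contra hcon
      push Not at hcon
      have hall : ∀ s ∈ S, s ∈ l := by
        intro s hs
        have := hS s hs
        clear hs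
        induction this with
        | refl => exact h2
        | tail _ hbc ih' =>
          by_contra hc
          exact hcon _ _ ih' hc hbc.2 hbc.1
      have : S ⊆ l.toFinset := fun s hs => by simpa using hall s hs
      have := Finset.card_le_card this
      omega
    obtain ⟨a, b, ha, hb, hbS, hab⟩ := hedge
    obtain ⟨l1, l2, rfl⟩ := List.append_of_mem ha
    refine ⟨l1 ++ a :: b :: a :: l2, ?_, ?_, ?_, ?_, ?_⟩
    · rw [List.isChain_append] at h1 ⊢
      refine ⟨h1.1, ?_, ?_⟩
      · rw [List.isChain_cons_cons, List.isChain_cons_cons]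
        exact ⟨hab, hr _ _ hab, h1.2.1⟩
      · simpa using h1.2.2
    · simp only [List.mem_append, List.mem_cons] at h2 ⊢; tauto
    · intro x hx
      simp only [List.mem_append, List.mem_cons] at hx
      rcases hx with h | h | h | h | h
      · exact h3 x (by simp [h])
      · exact h3 x (by simp [h])
      · rw [h]; exact hbS
      · exact h3 x (by simp [h])
      · exact h3 x (by simp [h])
    · have : (l1 ++ a :: b :: a :: l2).toFinset = insert b (l1 ++ a :: l2).toFinset := by
        ext x
        simp only [List.mem_toFinset, List.mem_append, List.mem_cons, Finset.mem_insert]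
        tauto
      rw [this, Finset.card_insert_of_notMem (fun h => hb (List.mem_toFinset.1 h)), h4]
    · simp only [List.length_append, List.length_cons] at h5 ⊢
      omega

lemma exists_walk {α : Type*} (r : α → α → Prop) (hr : ∀ a b, r a b → r b a)
    (S : Finset α) (s₀ : α) (h₀ : s₀ ∈ S)
    (hS : ∀ s ∈ S, Relation.ReflTransGen (fun a b => r a b ∧ b ∈ S) s₀ s) :
    ∃ l : List α, l.IsChain r ∧ l.toFinset = S ∧ l.length = 2 * (S.card - 1) + 1 := by
  have hpos := Finset.card_pos.2 ⟨s₀, h₀⟩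
  obtain ⟨l, h1, h2, h3, h4, h5⟩ := exists_walk_aux r hr S s₀ h₀ hS (S.card - 1) (by omega)
  refine ⟨l, h1, ?_, h5⟩
  apply Finset.eq_of_subset_of_card_le
  · intro x hx; exact h3 x (by simpa using hx)
  · omega

end Connectivity

section Bridge

variable {n : ℕ}

lemma sum_powersetCard_eq_cobd (e : Finset (Fin n) → ZMod 2) {m : ℕ} {σ : Finset (Fin n)}
    (hσ : σ.card = m + 1) : ∑ τ ∈ Finset.powersetCard m σ, e τ = cobd e σ := by
  unfold cobd
  symm
  refine Finset.sum_nbij (fun x => σ.erase x) ?_ ?_ ?_ ?_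
  · intro x hx
    rw [Finset.mem_powersetCard]
    exact ⟨Finset.erase_subset _ _, by rw [Finset.card_erase_of_mem hx, hσ]; rfl⟩
  · intro x hx y hy h
    by_contra hne
    have h' : σ.erase x = σ.erase y := h
    have : x ∈ σ.erase y := Finset.mem_erase.2 ⟨hne, hx⟩
    rw [← h'] at this
    exact Finset.notMem_erase _ _ this
  · intro τ hτ
    obtain ⟨h1, h2⟩ := Finset.mem_powersetCard.1 (Finset.mem_coe.1 hτ)
    have hu : σ ∈ upper τ := mem_upper.2 ⟨h1, by omega⟩
    obtain ⟨v, hv, rfl⟩ := Finset.mem_image.1 hu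
    have hv' : v ∉ τ := by simpa using hv
    exact ⟨v, Finset.mem_insert_self _ _, Finset.erase_insert hv'⟩
  · intro _ _; rfl

/-- Extension of a cochain by zero. -/
noncomputable def extz {G : Set (Finset (Fin n))} {j : ℕ} (F : Cochain G j)
    (σ : Finset (Fin n)) : ZMod 2 :=
  if h : IsSimplex G j σ then F ⟨σ, h⟩ else 0

lemma coboundary_apply_eq {G : Set (Finset (Fin n))} {j : ℕ} (F : Cochain G j)
    (σ : {A : Finset (Fin n) // IsSimplex G (j + 1) A}) :
    coboundary G j F σ = cobd (extz F) σ := by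
  rw [← sum_powersetCard_eq_cobd (m := j + 1) _ σ.2.2]
  rfl

lemma isSimplex_low {k j : ℕ} (hj : j + 1 ≤ k) {t : Finset (Fin n) → ℝ} {p : ℝ}
    {σ : Finset (Fin n)} : IsSimplex (complexY k n t p) j σ ↔ σ.card = j + 1 := by
  unfold IsSimplex complexY
  constructor
  · exact fun h => h.2
  · intro h
    refine ⟨Or.inl ⟨?_, by omega⟩, h⟩
    rw [← Finset.card_pos]; omega

lemma isSimplex_top {k : ℕ} {t : Finset (Fin n) → ℝ} {p : ℝ}
    {σ : Finset (Fin n)} : IsSimplex (complexY k n t p) k σ ↔ σ.card = k + 1 ∧ t σ ≤ p := by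
  constructor
  · rintro ⟨h1 | h1, h2⟩
    · omega
    · exact h1
  · intro h
    exact ⟨Or.inr h, h.1⟩

/-- The set of `k`-simplices born by time `p`. -/
def born (t : Finset (Fin n) → ℝ) (p : ℝ) : Set (Finset (Fin n)) := {K | t K ≤ p}

lemma not_subsingleton_iff (i : ℕ) (t : Finset (Fin n) → ℝ) (p : ℝ) :
    ¬ Subsingleton (cohomology (complexY (i + 2) n t p) (i + 1)) ↔
      ∃ f : Finset (Fin n) → ZMod 2, Coc (i + 2) (born t p) f ∧
        ∀ g : Finset (Fin n) → ZMod 2, ¬ ∀ σ : Finset (Fin n), σ.card = i + 2 → f σ = cobd g σ := by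
  set G := complexY (i + 2) n t p with hG
  rw [Submodule.Quotient.subsingleton_iff]
  constructor
  · intro h
    have : ∃ z ∈ cocycles G (i + 1), z ∉ coboundaries G (i + 1) := by
      by_contra hcon
      push Not at hcon
      apply h
      rw [Submodule.eq_top_iff']
      intro z
      exact hcon z.1 z.2
    obtain ⟨z, hz1, hz2⟩ := this
    refine ⟨extz z, ?_, ?_⟩
    · intro K hK hY
      have hs : IsSimplex G (i + 2) K := isSimplex_top.2 ⟨hK, hY⟩
      have := congrFun (LinearMap.mem_ker.1 hz1) ⟨K, hs⟩
      rw [coboundary_apply_eq] at this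
      exact this
    · intro g hg
      apply hz2
      refine LinearMap.mem_range.2 ⟨fun τ => g τ.1, ?_⟩
      funext σ
      rw [coboundary_apply_eq]
      have h1 := hg σ.1 σ.2.2
      have h2 : extz z σ.1 = z σ := by
        unfold extz
        rw [dif_pos σ.2]
      rw [← h2, h1]
      apply cobd_congr (k := i + 1) _ σ.2.2
      intro τ hτ
      unfold extz
      rw [dif_pos ((isSimplex_low (by omega)).2 hτ)]
  · rintro ⟨f, hf1, hf2⟩ htop
    let z : Cochain G (i + 1) := fun σ => f σ.1
    have hext : ∀ σ : Finset (Fin n), σ.card = i + 2 → extz z σ = f σ := by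
      intro σ hσ
      unfold extz
      rw [dif_pos ((isSimplex_low (by omega)).2 hσ)]
    have hz : z ∈ cocycles G (i + 1) := by
      refine LinearMap.mem_ker.2 ?_
      funext K
      rw [coboundary_apply_eq, cobd_congr hext K.2.2]
      exact hf1 K.1 K.2.2 (isSimplex_top.1 K.2).2
    have hz2 : z ∈ coboundaries G (i + 1) := by
      have : (⟨z, hz⟩ : cocycles G (i + 1)) ∈
        (coboundaries G (i + 1)).comap (cocycles G (i + 1)).subtype := by rw [htop]; trivial
      exact this
    obtain ⟨g, hg⟩ := LinearMap.mem_range.1 hz2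
    apply hf2 (extz g)
    intro σ hσ
    have hs : IsSimplex G (i + 1) σ := (isSimplex_low (by omega)).2 hσ
    have := congrFun hg ⟨σ, hs⟩
    rw [coboundary_apply_eq] at this
    exact this.symm

lemma isol_iff (i : ℕ) (t : Finset (Fin n) → ℝ) (p : ℝ) :
    (∃ σ : Finset (Fin n), IsSimplex (complexY (i + 2) n t p) (i + 1) σ ∧
      ∀ K : Finset (Fin n), IsSimplex (complexY (i + 2) n t p) (i + 2) K → ¬ σ ⊆ K) ↔
    ∃ σ : Finset (Fin n), σ.card = i + 2 ∧ IsoAt (i + 2) (born t p) σ := by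
  constructor
  · rintro ⟨σ, h1, h2⟩
    exact ⟨σ, h1.2, fun K hK hY => h2 K (isSimplex_top.2 ⟨hK, hY⟩)⟩
  · rintro ⟨σ, h1, h2⟩
    exact ⟨σ, (isSimplex_low (by omega)).2 h1, fun K hK =>
      h2 K (isSimplex_top.1 hK).1 (isSimplex_top.1 hK).2⟩

lemma nontrivial_of_iso {k : ℕ} (hn : k + 1 ≤ n) {Y : Set (Finset (Fin n))} {σ : Finset (Fin n)}
    (hσ : σ.card = k) (hI : IsoAt k Y σ) :
    ∃ f : Finset (Fin n) → ZMod 2, Coc k Y f ∧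
        ∀ g : Finset (Fin n) → ZMod 2, ¬ ∀ σ : Finset (Fin n), σ.card = k → f σ = cobd g σ := by
  refine ⟨ind {σ}, ?_, ?_⟩
  · intro K hK hY
    refine Finset.sum_eq_zero fun x _ => ?_
    have : K.erase x ≠ σ := fun h => hI K hK hY (h ▸ Finset.erase_subset _ _)
    simp [ind, this]
  · intro g hg
    have : (upper σ).Nonempty := by rw [← Finset.card_pos, card_upper]; omega
    obtain ⟨K, hK⟩ := this
    obtain ⟨h1, h2⟩ := mem_upper.1 hK
    rw [hσ] at h2
    have h3 := cobd_congr hg h2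
    rw [cobd_cobd, cobd_single (ind {σ}) hσ h2 h1] at h3
    · simp [ind] at h3
    · intro τ _ _ hne
      simp [ind, hne]

lemma iso_of_nontrivial {k : ℕ} {Y₀ Y : Set (Finset (Fin n))} (hYY : Y₀ ⊆ Y)
    (H2 : ∀ σ τ : Finset (Fin n), σ.card = k → τ.card = k → (σ ∪ τ).card = k + 1 →
      IsoAt k Y₀ σ → IsoAt k Y₀ τ → False)
    (H3 : ∀ f, Coc k Y₀ f → GenIso k Y₀ f)
    {f : Finset (Fin n) → ZMod 2} (hf : Coc k Y f)
    (hnt : ∀ g : Finset (Fin n) → ZMod 2, ¬ ∀ σ : Finset (Fin n), σ.card = k → f σ = cobd g σ) :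
    ∃ σ : Finset (Fin n), σ.card = k ∧ IsoAt k Y σ := by
  obtain ⟨g, h, h1, h2⟩ := H3 f (fun K hK hY => hf K hK (hYY hY))
  have hne : ∃ σ : Finset (Fin n), σ.card = k ∧ h σ ≠ 0 := by
    by_contra hcon
    push Not at hcon
    refine hnt g fun σ hσ => ?_
    rw [h2 σ hσ, hcon σ hσ, add_zero]
  obtain ⟨σ, hσ, hσ0⟩ := hne
  refine ⟨σ, hσ, fun K hK hY hs => ?_⟩
  have e1 : cobd f K = cobd h K := by
    rw [cobd_congr (g := cobd g + h) (fun τ hτ => by rw [h2 τ hτ]; rfl) hK, cobd_add, cobd_cobd,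
      zero_add]
  rw [hf K hK hY, cobd_single h hσ hK hs] at e1
  · exact hσ0 e1.symm
  · intro τ hτ hτK hne
    by_contra h0
    have hu := union_eq_of_faces hσ hτ hK hs hτK (fun e => hne e.symm)
    exact H2 σ τ hσ hτ (by rw [hu, hK]) (h1 σ hσ hσ0) (h1 τ hτ h0)

lemma pConn_eq_pIsol {k : ℕ} (hk : 2 ≤ k) (hn : k + 1 ≤ n) (t : Finset (Fin n) → ℝ) (p₀ : ℝ)
    (hp : p₀ ∈ Set.Icc (0 : ℝ) 1)
    (H1 : ∃ σ : Finset (Fin n), σ.card = k ∧ IsoAt k (born t p₀) σ)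
    (H2 : ∀ σ τ : Finset (Fin n), σ.card = k → τ.card = k → (σ ∪ τ).card = k + 1 →
      IsoAt k (born t p₀) σ → IsoAt k (born t p₀) τ → False)
    (H3 : ∀ f, Coc k (born t p₀) f → GenIso k (born t p₀) f) :
    pConn k n t = pIsol k n t := by
  obtain ⟨i, rfl⟩ : ∃ i, k = i + 2 := ⟨k - 2, by omega⟩
  have e1 : pConn (i + 2) n t = sSup {p : ℝ | p ∈ Set.Icc (0 : ℝ) 1 ∧
      ∃ f : Finset (Fin n) → ZMod 2, Coc (i + 2) (born t p) f ∧
        ∀ g : Finset (Fin n) → ZMod 2, ¬ ∀ σ : Finset (Fin n), σ.card = i + 2 → f σ = cobd g σ} := by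
    unfold pConn
    congr 1
    ext p
    exact and_congr_right fun _ => not_subsingleton_iff i t p
  have e2 : pIsol (i + 2) n t = sSup {p : ℝ | p ∈ Set.Icc (0 : ℝ) 1 ∧
      ∃ σ : Finset (Fin n), σ.card = i + 2 ∧ IsoAt (i + 2) (born t p) σ} := by
    unfold pIsol
    congr 1
    ext p
    exact and_congr_right fun _ => isol_iff i t p
  rw [e1, e2]
  have hbdd : ∀ Q : ℝ → Prop, BddAbove {p : ℝ | p ∈ Set.Icc (0 : ℝ) 1 ∧ Q p} :=
    fun Q => ⟨1, fun p hp => hp.1.2⟩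
  apply le_antisymm
  · apply csSup_le
    · obtain ⟨σ, hσ, hI⟩ := H1
      exact ⟨p₀, hp, nontrivial_of_iso hn hσ hI⟩
    · rintro p ⟨hp01, f, hf, hnt⟩
      rcases le_total p p₀ with hle | hle
      · exact hle.trans (le_csSup (hbdd _) ⟨hp, H1⟩)
      · refine le_csSup (hbdd _) ⟨hp01, ?_⟩
        refine iso_of_nontrivial (Y₀ := born t p₀) ?_ H2 H3 hf hnt
        intro K hK
        exact le_trans (show t K ≤ p₀ from hK) hle
  · apply csSup_le_csSup (hbdd _)
    · exact ⟨p₀, hp, H1⟩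
    · rintro p ⟨hp01, σ, hσ, hI⟩
      exact ⟨hp01, nontrivial_of_iso hn hσ hI⟩

end Bridge

section Walks

variable {n : ℕ}

/-- The `(k+1)`-sets used by a walk. -/
noncomputable def kset : List (Finset (Fin n)) → Finset (Finset (Fin n))
  | [] => ∅
  | [_] => ∅
  | a :: b :: l => insert (a ∪ b) (kset (b :: l))

structure ValidW (k Δ : ℕ) (l : List (Finset (Fin n))) : Prop where
  card : ∀ a ∈ l, a.card = k
  chain : l.IsChain (fun a b => (a ∪ b).card = k + 1)
  deg : ∀ σ : Finset (Fin n), σ.card = k → ((kset l).filter (fun K => σ ⊆ K)).card ≤ Δ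

noncomputable def walks (k Δ : ℕ) : ℕ → Finset (List (Finset (Fin n)))
  | 0 => (layer n k).image (fun σ => [σ])
  | L + 1 => ((walks k Δ L ×ˢ layer n k).filter (fun x => ValidW k Δ (x.2 :: x.1))).image
      (fun x => x.2 :: x.1)

lemma kset_tail_subset (a : Finset (Fin n)) (l : List (Finset (Fin n))) : kset l ⊆ kset (a :: l) := by
  cases l with
  | nil => simp [kset]
  | cons b l => simp [kset]

lemma ValidW.tail {k Δ : ℕ} {a : Finset (Fin n)} {l : List (Finset (Fin n))}
    (h : ValidW k Δ (a :: l)) : ValidW k Δ l where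
  card := fun b hb => h.card b (List.mem_cons_of_mem _ hb)
  chain := h.chain.tail
  deg := fun σ hσ => (Finset.card_le_card
    (Finset.filter_subset_filter _ (kset_tail_subset a l))).trans (h.deg σ hσ)

lemma mem_walks {k Δ : ℕ} (L : ℕ) (l : List (Finset (Fin n))) (hl : l.length = L + 1)
    (hv : ValidW k Δ l) : l ∈ walks k Δ L := by
  induction L generalizing l with
  | zero =>
    obtain ⟨a, rfl⟩ := List.length_eq_one_iff.1 hl
    exact Finset.mem_image.2 ⟨a, mem_layer.2 (hv.card a (by simp)), rfl⟩
  | succ L ih =>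
    cases l with
    | nil => simp at hl
    | cons a l =>
      have h1 := ih l (by simpa using hl) hv.tail
      refine Finset.mem_image.2 ⟨(l, a), Finset.mem_filter.2 ⟨Finset.mem_product.2 ⟨h1,
        mem_layer.2 (hv.card a (by simp))⟩, hv⟩, rfl⟩

lemma walks_ne_nil {k Δ : ℕ} (L : ℕ) (l : List (Finset (Fin n))) (hl : l ∈ walks k Δ L) : l ≠ [] := by
  cases L with
  | zero =>
    obtain ⟨a, _, rfl⟩ := Finset.mem_image.1 hl
    simp
  | succ L =>
    obtain ⟨a, _, rfl⟩ := Finset.mem_image.1 hl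
    simp

/-- number of faces -/
lemma card_faces {k : ℕ} {K : Finset (Fin n)} (hK : K.card = k + 1) :
    ((layer n k).filter (fun τ => τ ⊆ K)).card ≤ k + 1 := by
  have : (layer n k).filter (fun τ => τ ⊆ K) ⊆ Finset.powersetCard k K := by
    intro τ hτ
    obtain ⟨h1, h2⟩ := Finset.mem_filter.1 hτ
    exact Finset.mem_powersetCard.2 ⟨h2, mem_layer.1 h1⟩
  refine (Finset.card_le_card this).trans ?_
  rw [Finset.card_powersetCard, hK]
  simp

lemma card_union_mem {k : ℕ} {σ : Finset (Fin n)}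
    (U : Finset (Finset (Fin n))) :
    ((layer n k).filter (fun τ => (τ ∪ σ).card = k + 1 ∧ τ ∪ σ ∈ U)).card
      ≤ (k + 1) * ((U.filter (fun K => σ ⊆ K ∧ K.card = k + 1)).card) := by
  have : (layer n k).filter (fun τ => (τ ∪ σ).card = k + 1 ∧ τ ∪ σ ∈ U) ⊆
      (U.filter (fun K => σ ⊆ K ∧ K.card = k + 1)).biUnion
        (fun K => (layer n k).filter (fun τ => τ ⊆ K)) := by
    intro τ hτ
    obtain ⟨h1, h2, h3⟩ := Finset.mem_filter.1 hτ
    exact Finset.mem_biUnion.2 ⟨τ ∪ σ, Finset.mem_filter.2 ⟨h3, Finset.subset_union_right, h2⟩,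
      Finset.mem_filter.2 ⟨h1, Finset.subset_union_left⟩⟩
  refine (Finset.card_le_card this).trans ?_
  rw [mul_comm]
  refine Finset.card_biUnion_le_card_mul _ _ _ fun K hK => card_faces (Finset.mem_filter.1 hK).2.2

lemma card_adj {k : ℕ} {σ : Finset (Fin n)} (hσ : σ.card = k) :
    ((layer n k).filter (fun τ => (τ ∪ σ).card = k + 1)).card ≤ (k + 1) * n := by
  have h := card_union_mem (k := k) (σ := σ) (upper σ)
  refine le_trans (Finset.card_le_card ?_) (h.trans (Nat.mul_le_mul_left _ ?_))
  · intro τ hτ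
    obtain ⟨h1, h2⟩ := Finset.mem_filter.1 hτ
    exact Finset.mem_filter.2 ⟨h1, h2, mem_upper.2 ⟨Finset.subset_union_right, by omega⟩⟩
  · refine (Finset.card_filter_le _ _).trans ?_
    rw [card_upper]; omega

lemma walk_step {k Δ : ℕ} {p : ℝ} (hp : 0 ≤ p) (l : List (Finset (Fin n))) (hl : l ≠ []) :
    ∑ σ ∈ (layer n k).filter (fun σ => ValidW k Δ (σ :: l)), p ^ (kset (σ :: l)).card
      ≤ p ^ (kset l).card * ((k + 1) * (Δ + n * p)) := by
  by_cases hemp : ∃ σ, ValidW k Δ (σ :: l)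
  swap
  · have : (layer n k).filter (fun σ => ValidW k Δ (σ :: l)) = ∅ := by
      apply Finset.filter_false_of_mem
      intro σ _ h
      exact hemp ⟨σ, h⟩
    rw [this, Finset.sum_empty]
    positivity
  obtain ⟨σ₁, hσ₁⟩ := hemp
  have hvl := hσ₁.tail
  obtain ⟨τ, l', rfl⟩ := List.exists_cons_of_ne_nil hl
  have hτ : τ.card = k := hvl.card τ (by simp)
  set U := kset (τ :: l') with hU
  have hsub : (layer n k).filter (fun σ => ValidW k Δ (σ :: τ :: l')) ⊆
      (layer n k).filter (fun σ => (σ ∪ τ).card = k + 1) := by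
    intro σ hσ
    obtain ⟨h1, h2⟩ := Finset.mem_filter.1 hσ
    refine Finset.mem_filter.2 ⟨h1, ?_⟩
    have := h2.chain
    rw [List.isChain_cons_cons] at this
    exact this.1
  calc _ ≤ ∑ σ ∈ (layer n k).filter (fun σ => (σ ∪ τ).card = k + 1),
          p ^ (kset (σ :: τ :: l')).card :=
        Finset.sum_le_sum_of_subset_of_nonneg hsub (fun _ _ _ => by positivity)
    _ ≤ ∑ σ ∈ (layer n k).filter (fun σ => (σ ∪ τ).card = k + 1),
          p ^ U.card * ((if σ ∪ τ ∈ U then 1 else 0) + p) := by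
        refine Finset.sum_le_sum fun σ _ => ?_
        show p ^ (insert (σ ∪ τ) U).card ≤ _
        by_cases h : σ ∪ τ ∈ U
        · rw [Finset.insert_eq_of_mem h, if_pos h]
          nlinarith [pow_nonneg hp U.card]
        · rw [Finset.card_insert_of_notMem h, if_neg h, pow_succ, zero_add]
    _ = p ^ U.card * ((((layer n k).filter (fun σ => (σ ∪ τ).card = k + 1 ∧ σ ∪ τ ∈ U)).card : ℝ)
          + (((layer n k).filter (fun σ => (σ ∪ τ).card = k + 1)).card : ℝ) * p) := by
        rw [← Finset.mul_sum, Finset.sum_add_distrib, Finset.sum_boole, Finset.filter_filter]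
        simp
    _ ≤ _ := by
        refine mul_le_mul_of_nonneg_left ?_ (by positivity)
        have h1 : ((layer n k).filter (fun σ => (σ ∪ τ).card = k + 1 ∧ σ ∪ τ ∈ U)).card
            ≤ (k + 1) * Δ := by
          refine (card_union_mem U).trans (Nat.mul_le_mul_left _ ?_)
          refine le_trans (Finset.card_le_card ?_) (hvl.deg τ hτ)
          intro K hK
          obtain ⟨a, b, c⟩ := Finset.mem_filter.1 hK
          exact Finset.mem_filter.2 ⟨a, b⟩
        have h2 := card_adj hτ
        have h1' : (((layer n k).filter (fun σ => (σ ∪ τ).card = k + 1 ∧ σ ∪ τ ∈ U)).card : ℝ)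
            ≤ (k + 1) * Δ := by exact_mod_cast h1
        have h2' : (((layer n k).filter (fun σ => (σ ∪ τ).card = k + 1)).card : ℝ)
            ≤ (k + 1) * n := by exact_mod_cast h2
        nlinarith [mul_le_mul_of_nonneg_right h2' hp]

lemma walks_sum {k Δ : ℕ} {p : ℝ} (hp : 0 ≤ p) (L : ℕ) :
    ∑ l ∈ walks (n := n) k Δ L, p ^ (kset l).card
      ≤ (n.choose k : ℝ) * ((k + 1) * (Δ + n * p)) ^ L := by
  induction L with
  | zero =>
    unfold walks
    rw [Finset.sum_image (by intro a _ b _ h; simpa using h)]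
    simp [kset, card_layer]
  | succ L ih =>
    unfold walks
    rw [Finset.sum_image (by
      rintro ⟨a, b⟩ _ ⟨c, d⟩ _ h
      simp only [List.cons.injEq] at h
      simp [h.1, h.2])]
    rw [Finset.sum_filter, Finset.sum_product]
    calc _ ≤ ∑ l ∈ walks (n := n) k Δ L, p ^ (kset l).card * ((k + 1) * (Δ + n * p)) := by
          refine Finset.sum_le_sum fun l hl => ?_
          rw [← Finset.sum_filter]
          exact walk_step hp l (walks_ne_nil L l hl)
      _ = (∑ l ∈ walks (n := n) k Δ L, p ^ (kset l).card) * ((k + 1) * (Δ + n * p)) := by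
          rw [Finset.sum_mul]
      _ ≤ _ := by
          rw [pow_succ, ← mul_assoc (n.choose k : ℝ)]
          exact mul_le_mul_of_nonneg_right ih (by positivity)

/-- odd `(k+1)`-sets of a family -/
noncomputable def oddSets (k : ℕ) (S : Finset (Finset (Fin n))) : Finset (Finset (Fin n)) :=
  supp (k + 1) (cobd (ind S))

lemma kset_born {k : ℕ} {Y : Set (Finset (Fin n))} (l : List (Finset (Fin n)))
    (h : l.IsChain (StepIn k Y)) : ∀ K ∈ kset l, K.card = k + 1 ∧ K ∈ Y := by
  induction l with
  | nil => simp [kset]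
  | cons a l ih =>
    cases l with
    | nil => simp [kset]
    | cons b l =>
      rw [List.isChain_cons_cons] at h
      intro K hK
      rcases Finset.mem_insert.1 hK with rfl | hK
      · exact h.1
      · exact ih h.2 K hK

/-- The finite set of walks contributing to the union bound, of support size `m`. -/
noncomputable def badWalks (n k Δ m : ℕ) : Finset (List (Finset (Fin n))) :=
  (walks k Δ (2 * (m - 1))).filter (fun l =>
    n * m ≤ (k + 1) * (oddSets k l.toFinset).card ∧
    m * ((n - k) - (m - 1)) ≤ (oddSets k l.toFinset).card)

lemma exists_badWalk {k Δ : ℕ} {Y : Set (Finset (Fin n))}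
    (hdeg : ∀ σ : Finset (Fin n), σ.card = k → ((upper σ).filter (fun K => K ∈ Y)).card ≤ Δ)
    {f₀ : Finset (Fin n) → ZMod 2} (hc : Coc k Y f₀) (hg : ¬ GenIso k Y f₀) :
    ∃ m ∈ Finset.Icc 2 (n.choose k), ∃ l ∈ badWalks n k Δ m, (∀ K ∈ kset l, K ∈ Y) ∧
      ∀ K ∈ oddSets k l.toFinset, K ∉ Y := by
  obtain ⟨f, hf, hmin, h2, σ₀, hσ₀, hconn⟩ := exists_connected hc hg
  obtain ⟨l, hl1, hl2₀, hl3⟩ := exists_walk (StepIn k Y)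
    (fun a b h => by unfold StepIn at h ⊢; rwa [Finset.union_comm b a]) (supp k f) σ₀ hσ₀ hconn
  have hl2 : l.toFinset = supp k f := by convert hl2₀
  have hkb := kset_born l hl1
  have hodd : oddSets k l.toFinset = supp (k + 1) (cobd f) := by
    ext K
    unfold oddSets
    rw [hl2, mem_supp, mem_supp]
    refine and_congr_right fun hK => ?_
    rw [cobd_congr (ind_supp f) hK]
  refine ⟨(supp k f).card, Finset.mem_Icc.2 ⟨h2, ?_⟩, l, Finset.mem_filter.2 ⟨?_, ?_, ?_⟩,
    fun K hK => (hkb K hK).2, ?_⟩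
  · rw [← card_layer]; exact Finset.card_filter_le _ _
  · refine mem_walks _ l hl3 ⟨?_, ?_, ?_⟩
    · intro a ha
      have : a ∈ supp k f := by rw [← hl2]; simpa using ha
      exact (mem_supp.1 this).1
    · exact hl1.imp fun a b h => h.1
    · intro σ hσ
      refine le_trans (Finset.card_le_card ?_) (hdeg σ hσ)
      intro K hK
      obtain ⟨h3, h4⟩ := Finset.mem_filter.1 hK
      obtain ⟨h5, h6⟩ := hkb K h3
      exact Finset.mem_filter.2 ⟨mem_upper.2 ⟨h4, by omega⟩, h6⟩
  · rw [hodd]; exact expansion f hmin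
  · rw [hodd]; exact small_expansion f
  · intro K hK hY
    rw [hodd] at hK
    obtain ⟨h3, h4⟩ := mem_supp.1 hK
    exact h4 (hf K h3 hY)

end Walks

section Probability

variable {n : ℕ}

instance : IsProbabilityMeasure (volume.restrict (Set.Icc (0 : ℝ) 1)) :=
  ⟨by simp⟩

instance (n : ℕ) : IsProbabilityMeasure (birthMeasure n) := by
  unfold birthMeasure; infer_instance

lemma unif_Iic {p : ℝ} (h1 : p ≤ 1) :
    (volume.restrict (Set.Icc (0 : ℝ) 1)) (Set.Iic p) = ENNReal.ofReal p := by
  rw [Measure.restrict_apply measurableSet_Iic]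
  have : Set.Iic p ∩ Set.Icc (0 : ℝ) 1 = Set.Icc 0 p := by
    ext x; simp only [Set.mem_inter_iff, Set.mem_Iic, Set.mem_Icc]
    constructor
    · rintro ⟨a, b, c⟩; exact ⟨b, a⟩
    · rintro ⟨a, b⟩; exact ⟨b, a, b.trans h1⟩
  rw [this, Real.volume_Icc, sub_zero]

lemma unif_Ioi {p : ℝ} (h0 : 0 ≤ p) :
    (volume.restrict (Set.Icc (0 : ℝ) 1)) (Set.Ioi p) = ENNReal.ofReal (1 - p) := by
  rw [Measure.restrict_apply measurableSet_Ioi]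
  have : Set.Ioi p ∩ Set.Icc (0 : ℝ) 1 = Set.Ioc p 1 := by
    ext x; simp only [Set.mem_inter_iff, Set.mem_Ioi, Set.mem_Icc, Set.mem_Ioc]
    constructor
    · rintro ⟨a, b, c⟩; exact ⟨a, c⟩
    · rintro ⟨a, b⟩; exact ⟨a, h0.trans a.le, b⟩
  rw [this, Real.volume_Ioc]

lemma prob_disj {p : ℝ} (h0 : 0 ≤ p) (h1 : p ≤ 1) (A B : Finset (Finset (Fin n)))
    (hAB : Disjoint A B) :
    (birthMeasure n).real {t | (∀ K ∈ A, t K ≤ p) ∧ ∀ K ∈ B, p < t K}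
      = p ^ A.card * (1 - p) ^ B.card := by
  have hset : {t : Finset (Fin n) → ℝ | (∀ K ∈ A, t K ≤ p) ∧ ∀ K ∈ B, p < t K}
      = Set.pi Set.univ (fun K => if K ∈ A then Set.Iic p else if K ∈ B then Set.Ioi p
          else Set.univ) := by
    ext t
    simp only [Set.mem_pi, Set.mem_univ, true_implies]
    constructor
    · rintro ⟨h, h'⟩ K
      split_ifs with a b
      · exact h K a
      · exact h' K b
      · trivial
    · intro h
      refine ⟨fun K hK => ?_, fun K hK => ?_⟩
      · have := h K
        rw [if_pos hK] at this
        exact this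
      · have := h K
        rw [if_neg (fun hA => Finset.disjoint_left.1 hAB hA hK), if_pos hK] at this
        exact this
  rw [hset, measureReal_def, birthMeasure, Measure.pi_pi, ENNReal.toReal_prod]
  have hterm : ∀ K : Finset (Fin n), ((volume.restrict (Set.Icc (0 : ℝ) 1))
      (if K ∈ A then Set.Iic p else if K ∈ B then Set.Ioi p else Set.univ)).toReal
      = (if K ∈ A then p else 1) * (if K ∈ B then (1 - p) else 1) := by
    intro K
    by_cases hA : K ∈ A
    · have hB : K ∉ B := Finset.disjoint_left.1 hAB hA
      simp only [hA, hB, if_true, if_false, mul_one]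
      rw [unif_Iic h1, ENNReal.toReal_ofReal h0]
    · by_cases hB : K ∈ B
      · simp only [hA, hB, if_true, if_false, one_mul]
        rw [unif_Ioi h0, ENNReal.toReal_ofReal (by linarith)]
      · simp only [hA, hB, if_false, mul_one]
        rw [measure_univ, ENNReal.toReal_one]
  rw [Finset.prod_congr rfl (fun K _ => hterm K), Finset.prod_mul_distrib]
  simp [Finset.prod_ite, Finset.filter_mem_eq_inter]

lemma prob_le {p : ℝ} (h0 : 0 ≤ p) (h1 : p ≤ 1) (A B : Finset (Finset (Fin n))) :
    (birthMeasure n).real {t | (∀ K ∈ A, t K ≤ p) ∧ ∀ K ∈ B, p < t K}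
      ≤ p ^ A.card * (1 - p) ^ B.card := by
  by_cases hAB : Disjoint A B
  · exact (prob_disj h0 h1 A B hAB).le
  · rw [Finset.not_disjoint_iff] at hAB
    obtain ⟨K, hA, hB⟩ := hAB
    have : {t : Finset (Fin n) → ℝ | (∀ K ∈ A, t K ≤ p) ∧ ∀ K ∈ B, p < t K} = ∅ := by
      ext t
      simp only [Set.mem_empty_iff_false, iff_false]
      rintro ⟨h, h'⟩
      exact absurd (h K hA) (not_le.2 (h' K hB))
    rw [this, measureReal_empty]
    have : 0 ≤ 1 - p := by linarith
    positivity

/-- all members of `B` are unborn at time `p` -/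
def unborn (p : ℝ) (B : Finset (Finset (Fin n))) : Set (Finset (Fin n) → ℝ) :=
  {t | ∀ K ∈ B, p < t K}

lemma prob_unborn {p : ℝ} (h0 : 0 ≤ p) (h1 : p ≤ 1) (B : Finset (Finset (Fin n))) :
    (birthMeasure n).real (unborn p B) = (1 - p) ^ B.card := by
  have := prob_disj h0 h1 ∅ B (Finset.disjoint_empty_left _)
  simpa [unborn] using this

lemma measurableSet_unborn (p : ℝ) (B : Finset (Finset (Fin n))) : MeasurableSet (unborn p B) := by
  have : unborn p B = ⋂ K ∈ B, {t : Finset (Fin n) → ℝ | p < t K} := by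
    ext t; simp [unborn]
  rw [this]
  refine Finset.measurableSet_biInter _ fun K _ => ?_
  exact measurableSet_lt measurable_const (measurable_pi_apply K)

lemma second_moment {Ω ι : Type*} [MeasurableSpace Ω] (μ : Measure Ω) [IsProbabilityMeasure μ]
    (I : Finset ι) (A : ι → Set Ω) (hA : ∀ i, MeasurableSet (A i)) (q r : ℝ)
    (hq : ∀ i ∈ I, μ.real (A i) = q) (hr0 : 0 ≤ r)
    (hr : ∀ i ∈ I, ∀ j ∈ I, i ≠ j → μ.real (A i ∩ A j) ≤ r) :
    (I.card * q) ^ 2 * μ.real {ω | ∀ i ∈ I, ω ∉ A i} ≤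
      I.card * q + I.card ^ 2 * r - (I.card * q) ^ 2 := by
  set a : ℝ := I.card * q with ha
  set B : Set Ω := {ω | ∀ i ∈ I, ω ∉ A i} with hB
  have hBm : MeasurableSet B := by
    have : B = ⋂ i ∈ I, (A i)ᶜ := by ext ω; simp [hB]
    rw [this]
    exact Finset.measurableSet_biInter _ fun i _ => (hA i).compl
  have hIndInt : ∀ s : Set Ω, MeasurableSet s → Integrable (s.indicator (1 : Ω → ℝ)) μ := fun s hs =>
    (integrable_const (1 : ℝ)).indicator hs
  have h1 : ∀ i j ω, (A i).indicator (1 : Ω → ℝ) ω * (A j).indicator (1 : Ω → ℝ) ω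
      = (A i ∩ A j).indicator (1 : Ω → ℝ) ω := by
    intro i j ω
    by_cases h : ω ∈ A i <;> by_cases h' : ω ∈ A j <;> simp [h, h']
  have hpt : ∀ ω, a ^ 2 * B.indicator (1 : Ω → ℝ) ω ≤
      (∑ i ∈ I, ∑ j ∈ I, (A i ∩ A j).indicator (1 : Ω → ℝ) ω)
        - (2 * a) * (∑ i ∈ I, (A i).indicator (1 : Ω → ℝ) ω) + a ^ 2 := by
    intro ω
    have : (∑ i ∈ I, ∑ j ∈ I, (A i ∩ A j).indicator (1 : Ω → ℝ) ω)
        = (∑ i ∈ I, (A i).indicator (1 : Ω → ℝ) ω) ^ 2 := by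
      rw [sq, Finset.sum_mul_sum]
      exact Finset.sum_congr rfl fun i _ => Finset.sum_congr rfl fun j _ => (h1 i j ω).symm
    rw [this]
    by_cases h : ω ∈ B
    · have : ∑ i ∈ I, (A i).indicator (1 : Ω → ℝ) ω = 0 :=
        Finset.sum_eq_zero fun i hi => by simp [h i hi]
      rw [this]; simp [h]
    · simp only [h, not_false_eq_true, Set.indicator_of_notMem, mul_zero]
      nlinarith [sq_nonneg ((∑ i ∈ I, (A i).indicator (1 : Ω → ℝ) ω) - a)]
  have hI1 : Integrable (fun ω => ∑ i ∈ I, ∑ j ∈ I, (A i ∩ A j).indicator (1 : Ω → ℝ) ω) μ :=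
    integrable_finset_sum _ fun i _ => integrable_finset_sum _ fun j _ =>
      hIndInt _ ((hA i).inter (hA j))
  have hI2 : Integrable (fun ω => (2 * a) * ∑ i ∈ I, (A i).indicator (1 : Ω → ℝ) ω) μ :=
    (integrable_finset_sum _ fun i _ => hIndInt _ (hA i)).const_mul _
  have hI12 : Integrable (fun ω => (∑ i ∈ I, ∑ j ∈ I, (A i ∩ A j).indicator (1 : Ω → ℝ) ω)
        - (2 * a) * (∑ i ∈ I, (A i).indicator (1 : Ω → ℝ) ω)) μ := hI1.sub hI2
  have hmono := integral_mono (μ := μ) ((hIndInt B hBm).const_mul (a ^ 2))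
    (hI12.add (integrable_const (a ^ 2))) hpt
  have e1 : ∫ ω, a ^ 2 * B.indicator (1 : Ω → ℝ) ω ∂μ = a ^ 2 * μ.real B := by
    rw [integral_const_mul, integral_indicator_one hBm]
  have e2 : ∫ ω, ((∑ i ∈ I, ∑ j ∈ I, (A i ∩ A j).indicator (1 : Ω → ℝ) ω)
        - (2 * a) * (∑ i ∈ I, (A i).indicator (1 : Ω → ℝ) ω) + a ^ 2) ∂μ
      = (∑ i ∈ I, ∑ j ∈ I, μ.real (A i ∩ A j)) - 2 * a * (∑ i ∈ I, μ.real (A i)) + a ^ 2 := by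
    rw [integral_add hI12 (integrable_const _), integral_sub hI1 hI2,
      integral_const_mul, integral_finset_sum _ (fun i _ => hIndInt _ (hA i)),
      integral_finset_sum _ (fun i _ => integrable_finset_sum _ fun j _ =>
        hIndInt _ ((hA i).inter (hA j)))]
    congr 1
    · congr 1
      · refine Finset.sum_congr rfl fun i _ => ?_
        rw [integral_finset_sum _ (fun j _ => hIndInt _ ((hA i).inter (hA j)))]
        exact Finset.sum_congr rfl fun j _ => integral_indicator_one ((hA i).inter (hA j))
      · congr 1
        exact Finset.sum_congr rfl fun i _ => integral_indicator_one (hA i)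
    · simp
  have hmono' : a ^ 2 * μ.real B ≤
      (∑ i ∈ I, ∑ j ∈ I, μ.real (A i ∩ A j)) - 2 * a * (∑ i ∈ I, μ.real (A i)) + a ^ 2 := by
    rw [← e1, ← e2]; exact hmono
  have e3 : ∑ i ∈ I, μ.real (A i) = a := by
    rw [Finset.sum_congr rfl hq]; simp [ha]
  have e4 : ∑ i ∈ I, ∑ j ∈ I, μ.real (A i ∩ A j) ≤ a + I.card ^ 2 * r := by
    have : ∀ i ∈ I, ∑ j ∈ I, μ.real (A i ∩ A j) ≤ q + I.card * r := by
      intro i hi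
      calc _ ≤ ∑ j ∈ I, ((if i = j then q else 0) + r) := by
            refine Finset.sum_le_sum fun j hj => ?_
            by_cases h : i = j
            · subst h
              rw [Set.inter_self, hq i hi, if_pos rfl]; linarith
            · rw [if_neg h, zero_add]; exact hr i hi j hj h
        _ = _ := by
            rw [Finset.sum_add_distrib, Finset.sum_ite_eq, if_pos hi]; simp
    refine (Finset.sum_le_sum this).trans ?_
    rw [Finset.sum_const, nsmul_eq_mul, ha]
    nlinarith
  rw [e3] at hmono'
  nlinarith

lemma upper_inter_card {k : ℕ} {σ τ : Finset (Fin n)} (hσ : σ.card = k) (hτ : τ.card = k)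
    (hne : σ ≠ τ) : (upper σ ∩ upper τ).card ≤ 1 := by
  rw [Finset.card_le_one]
  intro K hK K' hK'
  have a := Finset.mem_inter.1 hK
  have b := Finset.mem_inter.1 hK'
  have a1 := mem_upper.1 a.1
  have a2 := mem_upper.1 a.2
  have b1 := mem_upper.1 b.1
  have b2 := mem_upper.1 b.2
  rw [← union_eq_of_faces hσ hτ (by omega) a1.1 a2.1 hne,
    ← union_eq_of_faces hσ hτ (by omega) b1.1 b2.1 hne]

lemma prob_two_iso {k : ℕ} {p : ℝ} (h0 : 0 ≤ p) (h1 : p ≤ 1)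
    {σ τ : Finset (Fin n)} (hσ : σ.card = k) (hτ : τ.card = k) (hne : σ ≠ τ) :
    (birthMeasure n).real (unborn p (upper σ) ∩ unborn p (upper τ))
      ≤ (1 - p) ^ (2 * (n - k) - 1) := by
  have : unborn p (upper σ) ∩ unborn p (upper τ) = unborn p (upper σ ∪ upper τ) := by
    ext t
    simp only [unborn, Set.mem_inter_iff, Set.mem_setOf_eq, Finset.mem_union]
    constructor
    · rintro ⟨h, h'⟩ K (hK | hK)
      · exact h K hK
      · exact h' K hK
    · intro h
      exact ⟨fun K hK => h K (Or.inl hK), fun K hK => h K (Or.inr hK)⟩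
  rw [this, prob_unborn h0 h1]
  apply pow_le_pow_of_le_one (by linarith) (by linarith)
  have e1 := Finset.card_union_add_card_inter (upper σ) (upper τ)
  have e2 := upper_inter_card hσ hτ hne
  rw [card_upper, card_upper, hσ, hτ] at e1
  omega

lemma iso_iff_unborn {k : ℕ} {p : ℝ} {t : Finset (Fin n) → ℝ} {σ : Finset (Fin n)}
    (hσ : σ.card = k) : IsoAt k (born t p) σ ↔ t ∈ unborn p (upper σ) := by
  constructor
  · intro h K hK
    obtain ⟨h1, h2⟩ := mem_upper.1 hK
    by_contra hlt
    exact h K (by omega) (not_lt.1 hlt) h1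
  · intro h K hK hY hs
    exact absurd (show t K ≤ p from hY) (not_le.2 (h K (mem_upper.2 ⟨hs, by omega⟩)))

/-- event: there is no isolated simplex -/
lemma prob_E1 {k : ℕ} {p : ℝ} (h0 : 0 ≤ p) (h1 : p < 1) (hn : k + 1 ≤ n) :
    (birthMeasure n).real {t | ¬ ∃ σ : Finset (Fin n), σ.card = k ∧ IsoAt k (born t p) σ}
      ≤ 1 / (n.choose k * (1 - p) ^ (n - k)) + p / (1 - p) := by
  have hp : 0 < 1 - p := by linarith
  have hN : (0 : ℝ) < n.choose k := by exact_mod_cast Nat.choose_pos (by omega)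
  have := second_moment (birthMeasure n) (layer n k) (fun σ => unborn p (upper σ))
    (fun σ => measurableSet_unborn p _) ((1 - p) ^ (n - k)) ((1 - p) ^ (2 * (n - k) - 1))
    (fun σ hσ => by rw [prob_unborn h0 h1.le, card_upper, mem_layer.1 hσ]) (by positivity)
    (fun σ hσ τ hτ hne => prob_two_iso h0 h1.le (mem_layer.1 hσ) (mem_layer.1 hτ) hne)
  have hset : {t : Finset (Fin n) → ℝ | ¬ ∃ σ : Finset (Fin n), σ.card = k ∧ IsoAt k (born t p) σ}
      = {t | ∀ σ ∈ layer n k, t ∉ unborn p (upper σ)} := by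
    ext t
    simp only [Set.mem_setOf_eq, not_exists, not_and, mem_layer]
    refine forall_congr' fun σ => forall_congr' fun hσ => ?_
    rw [iso_iff_unborn hσ]
  rw [hset]
  rw [card_layer] at this
  set q := (1 - p) ^ (n - k) with hq
  have hqpos : 0 < q := by positivity
  have hr : (1 - p) ^ (2 * (n - k) - 1) = q ^ 2 / (1 - p) := by
    rw [eq_div_iff hp.ne', ← pow_succ, hq, ← pow_mul]
    congr 1; omega
  rw [hr] at this
  set X := (birthMeasure n).real {t | ∀ σ ∈ layer n k, t ∉ unborn p (upper σ)}
  have hpos : 0 < (n.choose k * q : ℝ) ^ 2 := by positivity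
  rw [← mul_le_mul_iff_right₀ hpos]
  refine this.trans (le_of_eq ?_)
  field_simp
  ring

/-- event: two adjacent isolated simplices -/
lemma prob_E2 {k : ℕ} {p : ℝ} (h0 : 0 ≤ p) (h1 : p ≤ 1) :
    (birthMeasure n).real {t | ∃ σ τ : Finset (Fin n), σ.card = k ∧ τ.card = k ∧
      (σ ∪ τ).card = k + 1 ∧ IsoAt k (born t p) σ ∧ IsoAt k (born t p) τ}
      ≤ n.choose k * ((k + 1) * n) * (1 - p) ^ (2 * (n - k) - 1) := by
  have hp : 0 ≤ 1 - p := by linarith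
  have hsub : {t : Finset (Fin n) → ℝ | ∃ σ τ : Finset (Fin n), σ.card = k ∧ τ.card = k ∧
      (σ ∪ τ).card = k + 1 ∧ IsoAt k (born t p) σ ∧ IsoAt k (born t p) τ} ⊆
      ⋃ σ ∈ layer n k, ⋃ τ ∈ (layer n k).filter (fun τ => (τ ∪ σ).card = k + 1),
        (unborn p (upper σ) ∩ unborn p (upper τ)) := by
    rintro t ⟨σ, τ, hσ, hτ, hu, h3, h4⟩
    simp only [Set.mem_iUnion]
    refine ⟨σ, mem_layer.2 hσ, τ, Finset.mem_filter.2 ⟨mem_layer.2 hτ, by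
      rw [Finset.union_comm]; exact hu⟩, (iso_iff_unborn hσ).1 h3, (iso_iff_unborn hτ).1 h4⟩
  refine (measureReal_mono hsub (measure_ne_top _ _)).trans ?_
  refine (measureReal_biUnion_finset_le _ _).trans ?_
  have : ∀ σ ∈ layer n k, (birthMeasure n).real
      (⋃ τ ∈ (layer n k).filter (fun τ => (τ ∪ σ).card = k + 1),
        (unborn p (upper σ) ∩ unborn p (upper τ)))
      ≤ ((k + 1) * n) * (1 - p) ^ (2 * (n - k) - 1) := by
    intro σ hσ
    have hσ' := mem_layer.1 hσ
    refine (measureReal_biUnion_finset_le _ _).trans ?_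
    calc _ ≤ ∑ τ ∈ (layer n k).filter (fun τ => (τ ∪ σ).card = k + 1),
          (1 - p) ^ (2 * (n - k) - 1) := by
          refine Finset.sum_le_sum fun τ hτ => ?_
          obtain ⟨h3, h4⟩ := Finset.mem_filter.1 hτ
          refine prob_two_iso h0 h1 hσ' (mem_layer.1 h3) ?_
          rintro rfl
          rw [Finset.union_self] at h4
          omega
      _ ≤ _ := by
          rw [Finset.sum_const, nsmul_eq_mul]
          refine mul_le_mul_of_nonneg_right ?_ (by positivity)
          exact_mod_cast card_adj hσ'
  refine (Finset.sum_le_sum this).trans ?_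
  rw [Finset.sum_const, nsmul_eq_mul, card_layer]
  exact le_of_eq (by ring)

/-- event: some `(k-1)`-simplex has large degree -/
lemma prob_E3 {k Δ : ℕ} {p : ℝ} (h0 : 0 ≤ p) (h1 : p ≤ 1) :
    (birthMeasure n).real {t | ∃ σ : Finset (Fin n), σ.card = k ∧
      Δ < ((upper σ).filter (fun K => K ∈ born t p)).card}
      ≤ n.choose k * ((n * p) ^ Δ / Δ.factorial) := by
  have hsub : {t : Finset (Fin n) → ℝ | ∃ σ : Finset (Fin n), σ.card = k ∧
      Δ < ((upper σ).filter (fun K => K ∈ born t p)).card} ⊆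
      ⋃ σ ∈ layer n k, ⋃ A ∈ Finset.powersetCard Δ (upper σ),
        {t | (∀ K ∈ A, t K ≤ p) ∧ ∀ K ∈ (∅ : Finset (Finset (Fin n))), p < t K} := by
    rintro t ⟨σ, hσ, hlt⟩
    obtain ⟨A, hA1, hA2⟩ := Finset.exists_subset_card_eq hlt.le
    simp only [Set.mem_iUnion]
    refine ⟨σ, mem_layer.2 hσ, A, Finset.mem_powersetCard.2
      ⟨hA1.trans (Finset.filter_subset _ _), hA2⟩, fun K hK => ?_, by simp⟩
    exact (Finset.mem_filter.1 (hA1 hK)).2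
  refine (measureReal_mono hsub (measure_ne_top _ _)).trans ?_
  refine (measureReal_biUnion_finset_le _ _).trans ?_
  have : ∀ σ ∈ layer n k, (birthMeasure n).real
      (⋃ A ∈ Finset.powersetCard Δ (upper σ),
        {t | (∀ K ∈ A, t K ≤ p) ∧ ∀ K ∈ (∅ : Finset (Finset (Fin n))), p < t K})
      ≤ (n * p) ^ Δ / Δ.factorial := by
    intro σ hσ
    have hσ' := mem_layer.1 hσ
    refine (measureReal_biUnion_finset_le _ _).trans ?_
    calc _ ≤ ∑ A ∈ Finset.powersetCard Δ (upper σ), p ^ Δ := by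
          refine Finset.sum_le_sum fun A hA => ?_
          refine (prob_le h0 h1 A ∅).trans ?_
          rw [(Finset.mem_powersetCard.1 hA).2]; simp
      _ ≤ _ := by
          rw [Finset.sum_const, nsmul_eq_mul, Finset.card_powersetCard, card_upper, hσ']
          have : ((n - k).choose Δ : ℝ) ≤ (n : ℝ) ^ Δ / Δ.factorial := by
            refine le_trans ?_ (Nat.choose_le_pow_div Δ n)
            exact_mod_cast Nat.choose_le_choose Δ (Nat.sub_le n k)
          calc _ ≤ (n : ℝ) ^ Δ / Δ.factorial * p ^ Δ :=
                mul_le_mul_of_nonneg_right this (by positivity)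
            _ = _ := by rw [mul_pow]; ring
  refine (Finset.sum_le_sum this).trans ?_
  rw [Finset.sum_const, nsmul_eq_mul, card_layer]

/-- event: a bad walk exists -/
lemma prob_E4 {k Δ : ℕ} {p : ℝ} (h0 : 0 ≤ p) (h1 : p ≤ 1) (B : ℕ → ℝ)
    (hB : ∀ m d : ℕ, 2 ≤ m → n * m ≤ (k + 1) * d → m * ((n - k) - (m - 1)) ≤ d → (1 - p) ^ d ≤ B m) :
    (birthMeasure n).real {t | ∃ m ∈ Finset.Icc 2 (n.choose k), ∃ l ∈ badWalks n k Δ m,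
      (∀ K ∈ kset l, K ∈ born t p) ∧ ∀ K ∈ oddSets k l.toFinset, K ∉ born t p}
      ≤ ∑ m ∈ Finset.Icc 2 (n.choose k),
        (n.choose k * ((k + 1) * (Δ + n * p)) ^ (2 * (m - 1))) * B m := by
  have hp : 0 ≤ 1 - p := by linarith
  have hsub : {t : Finset (Fin n) → ℝ | ∃ m ∈ Finset.Icc 2 (n.choose k), ∃ l ∈ badWalks n k Δ m,
      (∀ K ∈ kset l, K ∈ born t p) ∧ ∀ K ∈ oddSets k l.toFinset, K ∉ born t p} ⊆
      ⋃ m ∈ Finset.Icc 2 (n.choose k), ⋃ l ∈ badWalks n k Δ m,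
        {t | (∀ K ∈ kset l, t K ≤ p) ∧ ∀ K ∈ oddSets k l.toFinset, p < t K} := by
    rintro t ⟨m, hm, l, hl, h3, h4⟩
    simp only [Set.mem_iUnion]
    exact ⟨m, hm, l, hl, h3, fun K hK => not_le.1 (h4 K hK)⟩
  refine (measureReal_mono hsub (measure_ne_top _ _)).trans ?_
  refine (measureReal_biUnion_finset_le _ _).trans ?_
  refine Finset.sum_le_sum fun m hm => ?_
  have hm2 := (Finset.mem_Icc.1 hm).1
  refine (measureReal_biUnion_finset_le _ _).trans ?_
  have hBm : ∀ l ∈ badWalks n k Δ m, (1 - p) ^ (oddSets k l.toFinset).card ≤ B m := by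
    intro l hl
    obtain ⟨_, h3, h4⟩ := Finset.mem_filter.1 hl
    exact hB m _ hm2 h3 h4
  have hB0 : 0 ≤ B m := by
    refine le_trans (pow_nonneg hp _) (hB m (n * m) hm2 ?_ ?_)
    · exact Nat.le_mul_of_pos_left _ (by omega)
    · rw [mul_comm n m]; exact Nat.mul_le_mul_left _ (by omega)
  calc _ ≤ ∑ l ∈ badWalks n k Δ m, p ^ (kset l).card * B m := by
        refine Finset.sum_le_sum fun l hl => ?_
        refine (prob_le h0 h1 _ _).trans ?_
        exact mul_le_mul_of_nonneg_left (hBm l hl) (by positivity)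
    _ ≤ ∑ l ∈ walks (n := n) k Δ (2 * (m - 1)), p ^ (kset l).card * B m :=
        Finset.sum_le_sum_of_subset_of_nonneg (Finset.filter_subset _ _)
          (fun _ _ _ => by positivity)
    _ = (∑ l ∈ walks (n := n) k Δ (2 * (m - 1)), p ^ (kset l).card) * B m := by
        rw [Finset.sum_mul]
    _ ≤ _ := mul_le_mul_of_nonneg_right (walks_sum h0 _) hB0

lemma prob_total {k : ℕ} (hk : 2 ≤ k) (Δ : ℕ) {p : ℝ} (h0 : 0 ≤ p) (h1 : p < 1) (hn : k + 1 ≤ n)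
    (B : ℕ → ℝ)
    (hB : ∀ m d : ℕ, 2 ≤ m → n * m ≤ (k + 1) * d → m * ((n - k) - (m - 1)) ≤ d → (1 - p) ^ d ≤ B m) :
    1 - ((1 / (n.choose k * (1 - p) ^ (n - k)) + p / (1 - p)) +
      n.choose k * ((k + 1) * n) * (1 - p) ^ (2 * (n - k) - 1) +
      n.choose k * ((n * p) ^ Δ / Δ.factorial) +
      ∑ m ∈ Finset.Icc 2 (n.choose k),
        (n.choose k * ((k + 1) * (Δ + n * p)) ^ (2 * (m - 1))) * B m)
      ≤ (birthMeasure n).real {t | pConn k n t = pIsol k n t} := by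
  have e1 := prob_E1 (n := n) h0 h1 hn
  have e2 := prob_E2 (n := n) (k := k) h0 h1.le
  have e3 := prob_E3 (n := n) (k := k) (Δ := Δ) h0 h1.le
  have e4 := prob_E4 (n := n) (k := k) (Δ := Δ) h0 h1.le B hB
  set S1 := {t : Finset (Fin n) → ℝ | ¬ ∃ σ : Finset (Fin n), σ.card = k ∧ IsoAt k (born t p) σ}
  set S2 := {t : Finset (Fin n) → ℝ | ∃ σ τ : Finset (Fin n), σ.card = k ∧ τ.card = k ∧
      (σ ∪ τ).card = k + 1 ∧ IsoAt k (born t p) σ ∧ IsoAt k (born t p) τ}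
  set S3 := {t : Finset (Fin n) → ℝ | ∃ σ : Finset (Fin n), σ.card = k ∧
      Δ < ((upper σ).filter (fun K => K ∈ born t p)).card}
  set S4 := {t : Finset (Fin n) → ℝ | ∃ m ∈ Finset.Icc 2 (n.choose k), ∃ l ∈ badWalks n k Δ m,
      (∀ K ∈ kset l, K ∈ born t p) ∧ ∀ K ∈ oddSets k l.toFinset, K ∉ born t p}
  set G := {t : Finset (Fin n) → ℝ | pConn k n t = pIsol k n t}
  have hcover : (Set.univ : Set (Finset (Fin n) → ℝ)) ⊆ G ∪ (S1 ∪ S2 ∪ S3 ∪ S4) := by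
    intro t _
    by_contra hcon
    simp only [Set.mem_union, not_or] at hcon
    obtain ⟨hG, ⟨⟨n1, n2⟩, n3⟩, n4⟩ := hcon
    apply hG
    refine pConn_eq_pIsol hk hn t p ⟨h0, h1.le⟩ (not_not.1 n1) ?_ ?_
    · intro σ τ a b c d e
      exact n2 ⟨σ, τ, a, b, c, d, e⟩
    · intro f hf
      by_contra hg
      refine n4 (exists_badWalk ?_ hf hg)
      intro σ hσ
      by_contra hlt
      exact n3 ⟨σ, hσ, not_le.1 hlt⟩
  have hle := measureReal_mono (μ := birthMeasure n) hcover
  have u1 := measureReal_union_le (μ := birthMeasure n) G (S1 ∪ S2 ∪ S3 ∪ S4)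
  have u2 := measureReal_union_le (μ := birthMeasure n) (S1 ∪ S2 ∪ S3) S4
  have u3 := measureReal_union_le (μ := birthMeasure n) (S1 ∪ S2) S3
  have u4 := measureReal_union_le (μ := birthMeasure n) S1 S2
  have u0 : (birthMeasure n).real Set.univ = 1 := by simp
  linarith

end Probability

section Asymptotics

lemma one_sub_pow_le_exp {p : ℝ} (h1 : p < 1) (d : ℕ) : (1 - p) ^ d ≤ Real.exp (-(p * d)) := by
  calc (1 - p) ^ d ≤ (Real.exp (-p)) ^ d :=
        pow_le_pow_left₀ (by linarith) (Real.one_sub_le_exp_neg p) d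
    _ = Real.exp (-(p * d)) := by rw [← Real.exp_nat_mul]; congr 1; ring

lemma exp_le_one_sub_pow {p : ℝ} (h1 : p < 1) (d : ℕ) :
    Real.exp (-(d * (p / (1 - p)))) ≤ (1 - p) ^ d := by
  have hp : 0 < 1 - p := by linarith
  have := Real.one_sub_inv_le_log_of_pos hp
  have e : 1 - (1 - p)⁻¹ = -(p / (1 - p)) := by field_simp; ring
  rw [e] at this
  calc Real.exp (-(d * (p / (1 - p)))) = (Real.exp (-(p / (1 - p)))) ^ d := by
        rw [← Real.exp_nat_mul]; congr 1; ring
    _ ≤ _ := pow_le_pow_left₀ (Real.exp_pos _).le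
        ((Real.le_log_iff_exp_le hp).1 this) d

lemma term_one {k n : ℕ} (hk : 2 ≤ k) {L p : ℝ} (hL : 0 ≤ L) (hn : (n : ℝ) = Real.exp L)
    (hnp : n * p = (k - 1 / 4) * L) (hp0 : 0 ≤ p) (hp : p * (8 * k + 1) ≤ 1) (hbig : 2 * k ≤ n) :
    1 / (n.choose k * (1 - p) ^ (n - k)) ≤ 2 ^ k * k.factorial * Real.exp (-(L / 8)) := by
  have hk' : (2 : ℝ) ≤ k := by exact_mod_cast hk
  have hp1 : p < 1 := by nlinarith
  have hN : Real.exp (k * L) / (2 ^ k * k.factorial) ≤ n.choose k := by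
    have h1 := Nat.pow_le_choose (α := ℝ) k n
    refine le_trans ?_ h1
    have h2 : (n : ℝ) / 2 ≤ ((n + 1 - k : ℕ) : ℝ) := by
      rw [Nat.cast_sub (by omega)]
      have : (2 * k : ℝ) ≤ n := by exact_mod_cast hbig
      push_cast; linarith
    rw [← div_div, Real.exp_nat_mul, ← hn, ← div_pow]
    exact div_le_div_of_nonneg_right (pow_le_pow_left₀ (by positivity) h2 k) (by positivity)
  have hq : Real.exp (-((k - 1 / 8) * L)) ≤ (1 - p) ^ (n - k) := by
    have h1 : (1 - p) ^ n ≤ (1 - p) ^ (n - k) :=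
      pow_le_pow_of_le_one (by linarith) (by linarith) (Nat.sub_le _ _)
    refine le_trans ?_ ((exp_le_one_sub_pow hp1 n).trans h1)
    apply Real.exp_le_exp.2
    have h3 : (1 - p)⁻¹ ≤ 1 + 1 / (8 * k) := by
      rw [inv_le_iff_one_le_mul₀ (by linarith)]
      have : (1 + 1 / (8 * k) : ℝ) * (1 - p) = 1 + (1 - p * (8 * k + 1)) / (8 * k) := by
        field_simp; ring
      rw [this]
      have : 0 ≤ (1 - p * (8 * k + 1)) / (8 * k) := div_nonneg (by linarith) (by positivity)
      linarith
    have h4 : (n : ℝ) * (p / (1 - p)) = ((k - 1 / 4) * L) * (1 - p)⁻¹ := by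
      rw [← hnp]; ring
    rw [h4]
    have h5 : ((k - 1 / 4) * L) * (1 - p)⁻¹ ≤ ((k - 1 / 4) * L) * (1 + 1 / (8 * k)) :=
      mul_le_mul_of_nonneg_left h3 (mul_nonneg (by linarith) hL)
    have h6 : ((k - 1 / 4) * L) * (1 + 1 / (8 * k) : ℝ) = (k - 1 / 8) * L - L / (32 * k) := by
      field_simp; ring
    have h7 : 0 ≤ L / (32 * k) := by positivity
    linarith
  have hD : (0 : ℝ) < 2 ^ k * k.factorial := by positivity
  have hlow : Real.exp (L / 8) / (2 ^ k * k.factorial) ≤ n.choose k * (1 - p) ^ (n - k) := by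
    calc Real.exp (L / 8) / (2 ^ k * k.factorial)
        = Real.exp (k * L) / (2 ^ k * k.factorial) * Real.exp (-((k - 1 / 8) * L)) := by
          rw [div_mul_eq_mul_div, ← Real.exp_add]; congr 2; ring
      _ ≤ _ := mul_le_mul hN hq (Real.exp_pos _).le (by positivity)
  calc 1 / (n.choose k * (1 - p) ^ (n - k)) ≤ 1 / (Real.exp (L / 8) / (2 ^ k * k.factorial)) :=
        one_div_le_one_div_of_le (by positivity) hlow
    _ = _ := by rw [Real.exp_neg]; field_simp

lemma choose_le_exp {k n : ℕ} {L : ℝ} (hn : (n : ℝ) = Real.exp L) :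
    (n.choose k : ℝ) ≤ Real.exp (k * L) := by
  rw [Real.exp_nat_mul, ← hn]; exact_mod_cast Nat.choose_le_pow n k

lemma term_two {k n : ℕ} (hk : 2 ≤ k) {L p : ℝ} (hL : 0 ≤ L) (hn : (n : ℝ) = Real.exp L)
    (hnp : n * p = (k - 1 / 4) * L) (hp0 : 0 ≤ p) (hp1 : p < 1) (hbig : 40 * k + 40 ≤ n) :
    n.choose k * ((k + 1) * n) * (1 - p) ^ (2 * (n - k) - 1)
      ≤ (k + 1) * Real.exp (-(L / 4)) := by
  have hk' : (2 : ℝ) ≤ k := by exact_mod_cast hk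
  have h1 := one_sub_pow_le_exp hp1 (2 * (n - k) - 1)
  have h2 : (n : ℝ) * (19 / 10) ≤ ((2 * (n - k) - 1 : ℕ) : ℝ) := by
    have : n * 19 ≤ 10 * (2 * (n - k) - 1) := by omega
    have : (n : ℝ) * 19 ≤ 10 * ((2 * (n - k) - 1 : ℕ) : ℝ) := by exact_mod_cast this
    linarith
  have h3 : p * (n * (19 / 10)) ≤ p * ((2 * (n - k) - 1 : ℕ) : ℝ) := mul_le_mul_of_nonneg_left h2 hp0
  have h4 : p * (n * (19 / 10)) = (k - 1 / 4) * L * (19 / 10) := by rw [← hnp]; ring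
  calc n.choose k * ((k + 1) * n) * (1 - p) ^ (2 * (n - k) - 1)
      ≤ Real.exp (k * L) * ((k + 1) * Real.exp L) * Real.exp (-((k - 1 / 4) * L * (19 / 10))) := by
        have := choose_le_exp (k := k) hn
        rw [hn]
        refine mul_le_mul (mul_le_mul_of_nonneg_right this (by positivity))
          (h1.trans (Real.exp_le_exp.2 (by linarith))) (pow_nonneg (by linarith) _) (by positivity)
    _ = (k + 1) * Real.exp (k * L + L + -((k - 1 / 4) * L * (19 / 10))) := by
        rw [Real.exp_add, Real.exp_add]; ring
    _ ≤ _ := by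
        refine mul_le_mul_of_nonneg_left (Real.exp_le_exp.2 ?_) (by positivity)
        nlinarith

lemma term_three {k n : ℕ} (hk : 2 ≤ k) {L p : ℝ} (hL : 0 ≤ L) (hn : (n : ℝ) = Real.exp L)
    (hnp : n * p = (k - 1 / 4) * L) (hp0 : 0 ≤ p) {Δ : ℕ} (hΔ : 16 * ((k - 1 / 4) * L) ≤ Δ) :
    n.choose k * ((n * p) ^ Δ / Δ.factorial) ≤ Real.exp (-L) := by
  have hk' : (2 : ℝ) ≤ k := by exact_mod_cast hk
  set a : ℝ := (k - 1 / 4) * L with ha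
  have ha0 : 0 ≤ a := mul_nonneg (by linarith) hL
  have h1 := Real.pow_div_factorial_le_exp (x := 8 * a) (by positivity) Δ
  have h2 : Real.exp Δ ≤ 8 ^ Δ := by
    have : Real.exp Δ = Real.exp 1 ^ Δ := by rw [← Real.exp_nat_mul]; simp
    rw [this]
    exact pow_le_pow_left₀ (Real.exp_pos _).le (by linarith [Real.exp_one_lt_d9]) _
  have h3 : (a ^ Δ / Δ.factorial) * Real.exp Δ ≤ Real.exp (8 * a) := by
    refine le_trans ?_ h1
    rw [mul_pow 8 a, mul_comm (8 ^ Δ : ℝ), mul_div_right_comm]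
    exact mul_le_mul_of_nonneg_left h2 (by positivity)
  have h4 : a ^ Δ / Δ.factorial ≤ Real.exp (8 * a - Δ) := by
    rw [Real.exp_sub, le_div_iff₀ (Real.exp_pos _)]; exact h3
  rw [hnp]
  calc n.choose k * (a ^ Δ / Δ.factorial) ≤ Real.exp (k * L) * Real.exp (8 * a - Δ) :=
        mul_le_mul (choose_le_exp hn) h4 (by positivity) (Real.exp_pos _).le
    _ = Real.exp (k * L + (8 * a - Δ)) := by rw [Real.exp_add]
    _ ≤ _ := by
        apply Real.exp_le_exp.2
        have : k * L + L ≤ 8 * a := by rw [ha]; nlinarith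
        linarith

lemma bound_B {k n : ℕ} (hk : 2 ≤ k) {L p : ℝ} (hL : 0 ≤ L)
    (hnp : n * p = (k - 1 / 4) * L) (hp0 : 0 ≤ p) (hp1 : p < 1) (hbig : 40 * k + 40 ≤ n)
    (m d : ℕ) (hm : 2 ≤ m) (hd1 : n * m ≤ (k + 1) * d) (hd2 : m * ((n - k) - (m - 1)) ≤ d) :
    (1 - p) ^ d ≤ Real.exp (-((k + m / 4) * L)) := by
  have hk' : (2 : ℝ) ≤ k := by exact_mod_cast hk
  have hm' : (2 : ℝ) ≤ m := by exact_mod_cast hm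
  refine (one_sub_pow_le_exp hp1 d).trans (Real.exp_le_exp.2 (neg_le_neg ?_))
  by_cases h : m ≤ 2 * (k + 1)
  · have h1 : 6 * n ≤ 7 * ((n - k) - (m - 1)) := by omega
    have h2 : m * (6 * n) ≤ 7 * d :=
      (Nat.mul_le_mul_left m h1).trans (by linarith)
    have h2' : (m : ℝ) * (6 * n) ≤ 7 * d := by exact_mod_cast h2
    have h3 : p * (m * (6 * n)) ≤ p * (7 * d) := mul_le_mul_of_nonneg_left h2' hp0
    have h4 : p * (m * (6 * n)) = 6 * m * ((k - 1 / 4) * L) := by rw [← hnp]; ring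
    have h5 : 7 * (k + m / 4 : ℝ) ≤ 6 * m * (k - 1 / 4) := by nlinarith
    have h6 := mul_le_mul_of_nonneg_right h5 hL
    linarith
  · have h' : (2 * (k + 1) : ℝ) ≤ m := by
      have : 2 * (k + 1) ≤ m := by omega
      exact_mod_cast this
    have h2' : (n : ℝ) * m ≤ (k + 1) * d := by exact_mod_cast hd1
    have h3 : p * (n * m) ≤ p * ((k + 1) * d) := mul_le_mul_of_nonneg_left h2' hp0
    have h4 : p * (n * m) = m * ((k - 1 / 4) * L) := by rw [← hnp]; ring
    have h5 : (k + m / 4 : ℝ) * (k + 1) ≤ m * (k - 1 / 4) := by nlinarith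
    have h6 := mul_le_mul_of_nonneg_right h5 hL
    have h7 : ((k + m / 4) * L) * (k + 1 : ℝ) ≤ (p * d) * (k + 1) := by linarith
    exact le_of_mul_le_mul_right h7 (by positivity)

lemma term_four {k n : ℕ} {L Q : ℝ} (hn : (n : ℝ) = Real.exp L)
    (hQ : 1 ≤ Q) (hr : Q ^ 2 * Real.exp (-(L / 4)) ≤ 1 / 2) (N : ℕ) :
    ∑ m ∈ Finset.Icc 2 N, (n.choose k * Q ^ (2 * (m - 1))) * Real.exp (-((k + m / 4) * L))
      ≤ 4 * (Q ^ 2 * Real.exp (-(L / 4))) := by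
  set r : ℝ := Q ^ 2 * Real.exp (-(L / 4)) with hr'
  have hr0 : 0 ≤ r := by positivity
  have h1 : ∀ m ∈ Finset.Icc 2 N,
      (n.choose k * Q ^ (2 * (m - 1))) * Real.exp (-((k + m / 4) * L)) ≤ 2 * r * (1 / 2) ^ m := by
    intro m hm
    obtain ⟨hm, -⟩ := Finset.mem_Icc.1 hm
    calc (n.choose k * Q ^ (2 * (m - 1))) * Real.exp (-((k + m / 4) * L))
        ≤ (Real.exp (k * L) * Q ^ (2 * m)) * Real.exp (-((k + m / 4) * L)) := by
          refine mul_le_mul_of_nonneg_right ?_ (Real.exp_pos _).le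
          exact mul_le_mul (choose_le_exp hn) (pow_le_pow_right₀ hQ (by omega)) (by positivity)
            (Real.exp_pos _).le
      _ = r ^ m := by
          have : Real.exp (-((k + m / 4) * L)) = Real.exp (-(k * L)) * Real.exp (-(L / 4)) ^ m := by
            rw [← Real.exp_nat_mul, ← Real.exp_add]; congr 1; ring
          rw [this, hr', mul_pow, ← pow_mul, Real.exp_neg (k * L)]
          field_simp
      _ = r * r ^ (m - 1) := by rw [← pow_succ']; congr 1; omega
      _ ≤ r * (1 / 2) ^ (m - 1) :=
          mul_le_mul_of_nonneg_left (pow_le_pow_left₀ hr0 hr _) hr0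
      _ = 2 * r * (1 / 2) ^ m := by
          obtain ⟨j, rfl⟩ : ∃ j, m = j + 1 := ⟨m - 1, by omega⟩
          rw [Nat.add_sub_cancel, pow_succ]; ring
  refine (Finset.sum_le_sum h1).trans ?_
  rw [← Finset.mul_sum]
  have h2 : ∑ m ∈ Finset.Icc 2 N, (1 / 2 : ℝ) ^ m ≤ 2 := by
    exact (summable_geometric_two.sum_le_tsum _ (fun _ _ => by positivity)).trans_eq
      tsum_geometric_two
  nlinarith

lemma div_one_sub_le {p : ℝ} (h0 : 0 ≤ p) (h : p ≤ 1 / 2) : p / (1 - p) ≤ 2 * p := by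
  rw [div_le_iff₀ (by linarith)]; nlinarith

/-- the error bound as a function of `L = log n` -/
noncomputable def errL (k : ℕ) (L : ℝ) : ℝ :=
  2 ^ k * k.factorial * Real.exp (-(L / 8)) + 2 * ((k - 1 / 4) * (L * Real.exp (-L)))
    + (k + 1) * Real.exp (-(L / 4)) + Real.exp (-L)
    + 4 * (((k + 1) * (17 * k + 1)) ^ 2 * (L ^ 2 * Real.exp (-(L / 4))))

set_option maxHeartbeats 1000000 in
lemma prob_ge {k n : ℕ} (hk : 2 ≤ k) (hbig : 40 * k + 40 ≤ n)
    (hp : ((k - 1 / 4) * (Real.log n * Real.exp (-Real.log n))) * (8 * k + 1) ≤ 1)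
    (hL : 1 ≤ Real.log n)
    (hr : ((k + 1) * (17 * k + 1)) ^ 2 * (Real.log n ^ 2 * Real.exp (-(Real.log n / 4))) ≤ 1 / 2) :
    1 - errL k (Real.log n) ≤ (birthMeasure n).real {t | pConn k n t = pIsol k n t} := by
  have hk' : (2 : ℝ) ≤ k := by exact_mod_cast hk
  have hn0 : (0 : ℝ) < n := by
    have : 0 < n := by omega
    exact_mod_cast this
  have hn : (n : ℝ) = Real.exp (Real.log n) := (Real.exp_log hn0).symm
  set L := Real.log n with hLdef
  set p : ℝ := (k - 1 / 4) * (L * Real.exp (-L)) with hpdef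
  have hL0 : 0 ≤ L := by linarith
  have hp0 : 0 ≤ p := mul_nonneg (by linarith) (by positivity)
  have hp1 : p < 1 := by nlinarith
  have hp2 : p ≤ 1 / 2 := by nlinarith
  have hnp : n * p = (k - 1 / 4) * L := by
    rw [hpdef, hn, Real.exp_neg]; field_simp
  set a : ℝ := (k - 1 / 4) * L with ha
  have ha0 : 0 ≤ a := mul_nonneg (by linarith) hL0
  set Δ : ℕ := ⌈16 * a⌉₊ with hΔ
  have hΔ1 : 16 * a ≤ Δ := Nat.le_ceil _
  have hΔ2 : (Δ : ℝ) < 16 * a + 1 := Nat.ceil_lt_add_one (by positivity)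
  have hal : a ≤ k * L := by rw [ha]; nlinarith
  set Q : ℝ := (k + 1) * (Δ + n * p) with hQ
  have hQ1 : 1 ≤ Q := by
    have : 1 ≤ a := by rw [ha]; nlinarith
    rw [hQ, hnp]; nlinarith
  have hQ2 : Q ≤ (k + 1) * (17 * k + 1) * L := by
    rw [hQ, hnp, mul_assoc]
    exact mul_le_mul_of_nonneg_left (by nlinarith) (by positivity)
  have hQr : Q ^ 2 * Real.exp (-(L / 4)) ≤
      ((k + 1) * (17 * k + 1)) ^ 2 * (L ^ 2 * Real.exp (-(L / 4))) := by
    rw [← mul_assoc, ← mul_pow]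
    exact mul_le_mul_of_nonneg_right (pow_le_pow_left₀ (by linarith) hQ2 2) (Real.exp_pos _).le
  have main := prob_total hk Δ hp0 hp1 (n := n) (by omega)
    (fun m => Real.exp (-((k + m / 4) * L))) (fun m d hm h1 h2 =>
      bound_B hk hL0 hnp hp0 hp1 hbig m d hm h1 h2)
  refine le_trans ?_ main
  have t1 := term_one hk hL0 hn hnp hp0 hp (by omega)
  have t2 := term_two hk hL0 hn hnp hp0 hp1 hbig
  have t3 := term_three hk hL0 hn hnp hp0 hΔ1
  have t4 := term_four (k := k) hn hQ1 (hQr.trans hr) (n.choose k)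
  have t5 : p / (1 - p) ≤ 2 * p := by
    exact div_one_sub_le hp0 hp2
  unfold errL
  linarith

lemma tendsto_pow_exp (j : ℕ) {b : ℝ} (hb : 0 < b) :
    Tendsto (fun L : ℝ => L ^ j * Real.exp (-(L / b))) atTop (nhds 0) := by
  have h := (Real.tendsto_pow_mul_exp_neg_atTop_nhds_zero j).comp
    (tendsto_id.atTop_div_const hb)
  have h2 := h.const_mul (b ^ j)
  rw [mul_zero] at h2
  refine h2.congr fun L => ?_
  simp only [Function.comp, id]
  rw [div_pow]; field_simp

lemma tendsto_errL (k : ℕ) : Tendsto (errL k) atTop (nhds 0) := by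
  have e8 : Tendsto (fun L : ℝ => Real.exp (-(L / 8))) atTop (nhds 0) := by
    simpa using tendsto_pow_exp 0 (b := 8) (by norm_num)
  have e4 : Tendsto (fun L : ℝ => Real.exp (-(L / 4))) atTop (nhds 0) := by
    simpa using tendsto_pow_exp 0 (b := 4) (by norm_num)
  have e1 : Tendsto (fun L : ℝ => Real.exp (-L)) atTop (nhds 0) := by
    simpa using tendsto_pow_exp 0 (b := 1) (by norm_num)
  have l1 : Tendsto (fun L : ℝ => L * Real.exp (-L)) atTop (nhds 0) := by
    simpa using tendsto_pow_exp 1 (b := 1) (by norm_num)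
  have l4 := tendsto_pow_exp 2 (b := 4) (by norm_num)
  have := ((((e8.const_mul (2 ^ k * k.factorial : ℝ)).add
    ((l1.const_mul (k - 1 / 4 : ℝ)).const_mul 2)).add (e4.const_mul (k + 1 : ℝ))).add e1).add
    ((l4.const_mul (((k + 1) * (17 * k + 1)) ^ 2 : ℝ)).const_mul 4)
  simp only [mul_zero, add_zero] at this
  exact this

end Asymptotics

/-- Corollary 1.6: whp `p_conn = p_isol`. -/
theorem statement3 (k : ℕ) (hk : 2 ≤ k) :
    Tendsto (fun n : ℕ => birthMeasure n {t : Finset (Fin n) → ℝ |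
      pConn k n t = pIsol k n t}) atTop (nhds 1) := by
  have hlog : Tendsto (fun n : ℕ => Real.log n) atTop atTop :=
    Real.tendsto_log_atTop.comp tendsto_natCast_atTop_atTop
  have hreal : Tendsto (fun n : ℕ => (birthMeasure n).real {t : Finset (Fin n) → ℝ |
      pConn k n t = pIsol k n t}) atTop (nhds 1) := by
    have hlow : Tendsto (fun n : ℕ => 1 - errL k (Real.log n)) atTop (nhds 1) := by
      simpa using ((tendsto_errL k).comp hlog).const_sub 1
    refine tendsto_of_tendsto_of_tendsto_of_le_of_le' hlow tendsto_const_nhds ?_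
      (Eventually.of_forall fun n => measureReal_le_one)
    have l1 : Tendsto (fun L : ℝ => ((k - 1 / 4) * (L * Real.exp (-L))) * (8 * k + 1))
        atTop (nhds 0) := by
      have : Tendsto (fun L : ℝ => L * Real.exp (-L)) atTop (nhds 0) := by
        simpa using tendsto_pow_exp 1 (b := 1) (by norm_num)
      simpa using (this.const_mul (k - 1 / 4 : ℝ)).mul_const (8 * k + 1 : ℝ)
    have l2 : Tendsto (fun L : ℝ => ((k + 1) * (17 * k + 1) : ℝ) ^ 2 *
        (L ^ 2 * Real.exp (-(L / 4)))) atTop (nhds 0) := by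
      simpa using (tendsto_pow_exp 2 (b := 4) (by norm_num)).const_mul
        (((k + 1) * (17 * k + 1) : ℝ) ^ 2)
    filter_upwards [eventually_ge_atTop (40 * k + 40),
      (l1.comp hlog).eventually (eventually_le_nhds (show (0 : ℝ) < 1 by norm_num)),
      hlog.eventually (eventually_ge_atTop (1 : ℝ)),
      (l2.comp hlog).eventually (eventually_le_nhds (show (0 : ℝ) < 1 / 2 by norm_num))]
      with n h1 h2 h3 h4
    exact prob_ge hk h1 h2 h3 h4
  rw [← ENNReal.tendsto_toReal_iff (fun n => measure_ne_top _ _) ENNReal.one_ne_top]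
  simpa [measureReal_def] using hreal

end RSC
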